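/- arXiv:2309.09559 — 3 statements merged into one kernel-verified Lean document; each statement's English description precedes it below -/
import Mathlib

section
/- Let A be a Cartan datum consisting of a finite-dimensional quasi-toral Lie superalgebra h, linearly independent α_1,...,α_n in t* (t = h_0), h-modules g_{±α_i} of t-weight ±α_i, and nonzero h-module maps g_{α_i} ⊗ g_{−α_i} → h. Then in the Lie superalgebra g̃(A) generated by h and the g_{±α_i} subject to the defining relations, the positive part ñ⁺ is freely generated as a Lie superalgebra by the super vector space ⊕_i g_{α_i}. -/
/-- A complex Lie superalgebra, presented as a module with a ℤ/2-grading
(`even`/`odd` complementary submodules) and a bilinear bracket satisfying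
super skew-symmetry and the super Jacobi identity (stated case by case on
homogeneous elements). -/
structure SuperLie (L : Type*) [AddCommGroup L] [Module ℂ L] where
  even : Submodule ℂ L
  odd : Submodule ℂ L
  bracket : L →ₗ[ℂ] L →ₗ[ℂ] L
  compl : IsCompl even odd
  ee_mem : ∀ x ∈ even, ∀ y ∈ even, bracket x y ∈ even
  eo_mem : ∀ x ∈ even, ∀ y ∈ odd, bracket x y ∈ odd
  oe_mem : ∀ x ∈ odd, ∀ y ∈ even, bracket x y ∈ odd
  oo_mem : ∀ x ∈ odd, ∀ y ∈ odd, bracket x y ∈ even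
  skew_e : ∀ x ∈ even, ∀ y : L, bracket x y = - bracket y x
  symm_oo : ∀ x ∈ odd, ∀ y ∈ odd, bracket x y = bracket y x
  jacobi_e : ∀ x ∈ even, ∀ y z : L,
    bracket x (bracket y z) = bracket (bracket x y) z + bracket y (bracket x z)
  jacobi_oe : ∀ x ∈ odd, ∀ y ∈ even, ∀ z : L,
    bracket x (bracket y z) = bracket (bracket x y) z + bracket y (bracket x z)
  jacobi_oo : ∀ x ∈ odd, ∀ y ∈ odd, ∀ z : L,
    bracket x (bracket y z) = bracket (bracket x y) z - bracket y (bracket x z)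

/-- A submodule is an ideal for the bracket `b` if it absorbs brackets on both sides. -/
def IsBracketIdeal {L : Type*} [AddCommGroup L] [Module ℂ L]
    (b : L →ₗ[ℂ] L →ₗ[ℂ] L) (I : Submodule ℂ L) : Prop :=
  ∀ a : L, ∀ v ∈ I, b a v ∈ I ∧ b v a ∈ I

/-- The subalgebra (smallest bracket-closed submodule) generated by a subspace `P`. -/
def lieSpan {L : Type*} [AddCommGroup L] [Module ℂ L]
    (b : L →ₗ[ℂ] L →ₗ[ℂ] L) (P : Submodule ℂ L) : Submodule ℂ L :=
  sInf {N | P ≤ N ∧ ∀ x ∈ N, ∀ y ∈ N, b x y ∈ N}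

/-- `adPow b S T k` is the span of `[S,[S,…,[S,T]…]]` (`k` brackets); used to express
the integrability condition `(ad 𝔤_α)^k 𝔤_β = 0`. -/
def adPow {L : Type*} [AddCommGroup L] [Module ℂ L]
    (b : L →ₗ[ℂ] L →ₗ[ℂ] L) (S T : Submodule ℂ L) : ℕ → Submodule ℂ L
  | 0 => T
  | k + 1 => Submodule.span ℂ {z | ∃ x ∈ S, ∃ w ∈ adPow b S T k, z = b x w}

/-- A **Cartan datum**, realized inside an ambient Lie superalgebra `L`:
a finite-dimensional quasi-toral subalgebra `𝔥 = hE ⊕ hO`, linearly independent simple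
roots `α_1,…,α_n ∈ 𝔱*` (`𝔱 = hE`, each `alpha i` recorded as a functional on `L` whose
restriction to `hE` is the weight), graded `𝔥`-submodules `𝔤_{±α_i} = gp i, gm i` which are
weight spaces of weight `±α_i`, with `[𝔤_{α_i}, 𝔤_{-α_i}] ⊆ 𝔥`, `[𝔤_{α_i}, 𝔤_{-α_j}] = 0`
for `i ≠ j`, and the pairing `𝔤_{α_i} ⊗ 𝔤_{-α_i} → 𝔥` nondegenerate. -/
structure CartanDatum (L : Type*) [AddCommGroup L] [Module ℂ L] where
  sl : SuperLie L
  hE : Submodule ℂ L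
  hO : Submodule ℂ L
  hE_le : hE ≤ sl.even
  hO_le : hO ≤ sl.odd
  hfd : FiniteDimensional ℂ ↥(hE ⊔ hO)
  quasitoral : ∀ t ∈ hE, ∀ z ∈ hE ⊔ hO, sl.bracket t z = 0
  brOO : ∀ a ∈ hO, ∀ b ∈ hO, sl.bracket a b ∈ hE
  n : ℕ
  alpha : Fin n → (L →ₗ[ℂ] ℂ)
  indep : LinearIndependent ℂ fun i => (alpha i).domRestrict hE
  gp : Fin n → Submodule ℂ L
  gm : Fin n → Submodule ℂ L
  gp_fd : ∀ i, FiniteDimensional ℂ ↥(gp i)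
  gm_fd : ∀ i, FiniteDimensional ℂ ↥(gm i)
  gp_graded : ∀ i, gp i = (gp i ⊓ sl.even) ⊔ (gp i ⊓ sl.odd)
  gm_graded : ∀ i, gm i = (gm i ⊓ sl.even) ⊔ (gm i ⊓ sl.odd)
  gp_wt : ∀ i, ∀ t ∈ hE, ∀ v ∈ gp i, sl.bracket t v = alpha i t • v
  gm_wt : ∀ i, ∀ t ∈ hE, ∀ v ∈ gm i, sl.bracket t v = -(alpha i t) • v
  gp_mod : ∀ i, ∀ t ∈ hE ⊔ hO, ∀ v ∈ gp i, sl.bracket t v ∈ gp i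
  gm_mod : ∀ i, ∀ t ∈ hE ⊔ hO, ∀ v ∈ gm i, sl.bracket t v ∈ gm i
  pair_mem : ∀ i, ∀ x ∈ gp i, ∀ y ∈ gm i, sl.bracket x y ∈ hE ⊔ hO
  pair_ne : ∀ i j, i ≠ j → ∀ x ∈ gp i, ∀ y ∈ gm j, sl.bracket x y = 0
  nondeg_p : ∀ i, ∀ U : Submodule ℂ L, U ≤ gp i → U ≠ ⊥ →
    (∀ t ∈ hE ⊔ hO, ∀ u ∈ U, sl.bracket t u ∈ U) →
    ∃ u ∈ U, ∃ v ∈ gm i, sl.bracket u v ≠ 0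
  nondeg_m : ∀ i, ∀ U : Submodule ℂ L, U ≤ gm i → U ≠ ⊥ →
    (∀ t ∈ hE ⊔ hO, ∀ u ∈ U, sl.bracket t u ∈ U) →
    ∃ u ∈ U, ∃ v ∈ gp i, sl.bracket v u ≠ 0

namespace CartanDatum

variable {L : Type*} [AddCommGroup L] [Module ℂ L] (D : CartanDatum L)

/-- The Cartan subalgebra `𝔥`. -/
def h : Submodule ℂ L := D.hE ⊔ D.hO

/-- The generating subspace `𝒞 = ⊕ᵢ 𝔤_{-α_i} ⊕ 𝔥 ⊕ ⊕ᵢ 𝔤_{α_i}`. -/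
def genC : Submodule ℂ L := D.h ⊔ ((⨆ i, D.gp i) ⊔ (⨆ i, D.gm i))

/-- The positive part `𝔫⁺`: the subalgebra generated by the `𝔤_{α_i}`. -/
def Np : Submodule ℂ L := lieSpan D.sl.bracket (⨆ i, D.gp i)

/-- The negative part `𝔫⁻`. -/
def Nm : Submodule ℂ L := lieSpan D.sl.bracket (⨆ i, D.gm i)

/-- The coroot space `𝔥_{α_i} = [𝔤_{α_i}, 𝔤_{-α_i}]`. -/
def coroot (i : Fin D.n) : Submodule ℂ L :=
  Submodule.span ℂ {z | ∃ x ∈ D.gp i, ∃ y ∈ D.gm i, z = D.sl.bracket x y}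

/-- `D.Presented` says the ambient algebra *is* `𝔤̃(𝒜)`: it satisfies the universal
property of the presentation with generators `𝒞` and the defining relations.  Any
linear map to a Lie superalgebra `M` which respects, on `𝒞`, the parity, the bracket of
`𝔥`, the `𝔥`-module structure of the `𝔤_{±α_i}`, the pairings `[𝔤_{α_i}, 𝔤_{-α_i}]`, and
kills the mixed pairings, extends uniquely to a morphism of Lie superalgebras. -/
def Presented : Prop :=
  ∀ (M : Type*) [AddCommGroup M] [Module ℂ M] (sM : SuperLie M) (f : L →ₗ[ℂ] M),
    (∀ a ∈ D.h, ∀ b ∈ D.h, f (D.sl.bracket a b) = sM.bracket (f a) (f b)) →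
    (∀ i, ∀ t ∈ D.h, ∀ v ∈ D.gp i, f (D.sl.bracket t v) = sM.bracket (f t) (f v)) →
    (∀ i, ∀ t ∈ D.h, ∀ v ∈ D.gm i, f (D.sl.bracket t v) = sM.bracket (f t) (f v)) →
    (∀ i, ∀ x ∈ D.gp i, ∀ y ∈ D.gm i, f (D.sl.bracket x y) = sM.bracket (f x) (f y)) →
    (∀ i j, i ≠ j → ∀ x ∈ D.gp i, ∀ y ∈ D.gm j, sM.bracket (f x) (f y) = 0) →
    (∀ v ∈ D.genC, v ∈ D.sl.even → f v ∈ sM.even) →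
    (∀ v ∈ D.genC, v ∈ D.sl.odd → f v ∈ sM.odd) →
    ∃! F : L →ₗ[ℂ] M,
      (∀ a b : L, F (D.sl.bracket a b) = sM.bracket (F a) (F b)) ∧
      (∀ v ∈ D.sl.even, F v ∈ sM.even) ∧ (∀ v ∈ D.sl.odd, F v ∈ sM.odd) ∧
      (∀ v ∈ D.genC, F v = f v)

/-- `D.Reduced` says the ambient algebra *is* `𝔤(𝒜) = 𝔤̃(𝒜)/𝔯`: it has no nonzero
ideal intersecting `𝔥` trivially. -/
def Reduced : Prop :=
  ∀ I : Submodule ℂ L, IsBracketIdeal D.sl.bracket I → I ⊓ D.h = ⊥ → I = ⊥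

/-- The triangular decomposition property `𝔤 = 𝔫⁻ ⊕ 𝔥 ⊕ 𝔫⁺` (as a sum). -/
def Triangular : Prop := D.Nm ⊔ (D.h ⊔ D.Np) = ⊤

end CartanDatum

set_option linter.unusedSimpArgs false
namespace SuperLie

variable {L : Type*} [AddCommGroup L] [Module ℂ L] (s : SuperLie L)

/-- homogeneous part -/
def par (p : Bool) : Submodule ℂ L := if p then s.odd else s.even

/-- sign -/
def sg (p q : Bool) : ℂ := if p && q then -1 else 1

/-- odd projection -/
noncomputable def o : L →ₗ[ℂ] L := s.odd.projection s.even s.compl.symm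

/-- parity involution -/
noncomputable def sig : L →ₗ[ℂ] L := LinearMap.id - (2 : ℂ) • s.o

lemma o_mem (x : L) : s.o x ∈ s.odd := Submodule.projection_apply_mem _ x

lemma e_mem (x : L) : x - s.o x ∈ s.even := Submodule.sub_projection_mem _ x

lemma o_odd {x : L} (hx : x ∈ s.odd) : s.o x = x := Submodule.projection_apply_of_mem_left _ hx

lemma o_even {x : L} (hx : x ∈ s.even) : s.o x = 0 :=
  (Submodule.projection_apply_eq_zero_iff _).2 hx

lemma even_of_o {x : L} (hx : s.o x = 0) : x ∈ s.even :=
  (Submodule.projection_apply_eq_zero_iff _).1 hx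

lemma odd_of_o {x : L} (hx : s.o x = x) : x ∈ s.odd := hx ▸ s.o_mem x

lemma o_o (x : L) : s.o (s.o x) = s.o x := s.o_odd (s.o_mem x)

lemma sig_apply (x : L) : s.sig x = x - (2 : ℂ) • s.o x := rfl

lemma sig_odd {x : L} (hx : x ∈ s.odd) : s.sig x = -x := by
  rw [sig_apply, s.o_odd hx]; module

lemma sig_even {x : L} (hx : x ∈ s.even) : s.sig x = x := by
  rw [sig_apply, s.o_even hx]; module

lemma sig_sig (x : L) : s.sig (s.sig x) = x := by
  simp only [sig_apply, map_sub, map_smul, s.o_o]; module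

lemma o_eq_sig (x : L) : s.o x = (2⁻¹ : ℂ) • (x - s.sig x) := by
  rw [sig_apply]; module

lemma br_mem {p q : Bool} {x y : L} (hx : x ∈ s.par p) (hy : y ∈ s.par q) :
    s.bracket x y ∈ s.par (xor p q) := by
  cases p <;> cases q <;> simp [par] at *
  exacts [s.ee_mem _ hx _ hy, s.eo_mem _ hx _ hy, s.oe_mem _ hx _ hy, s.oo_mem _ hx _ hy]

lemma skew {p q : Bool} {x y : L} (hx : x ∈ s.par p) (hy : y ∈ s.par q) :
    s.bracket x y = -(sg p q • s.bracket y x) := by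
  cases p <;> cases q <;> simp [par, sg] at *
  exacts [s.skew_e _ hx _, s.skew_e _ hx _, by rw [s.skew_e _ hy x, neg_neg], s.symm_oo _ hx _ hy]

lemma jac {p q : Bool} {x y : L} (hx : x ∈ s.par p) (hy : y ∈ s.par q) (z : L) :
    s.bracket x (s.bracket y z) =
      s.bracket (s.bracket x y) z + sg p q • s.bracket y (s.bracket x z) := by
  cases p <;> cases q <;> simp [par, sg] at *
  exacts [s.jacobi_e _ hx _ _, s.jacobi_e _ hx _ _, s.jacobi_oe _ hx _ hy _, by
    rw [s.jacobi_oo _ hx _ hy, sub_eq_add_neg]]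

lemma skew_gen (x y : L) :
    s.bracket x y = - s.bracket y x + (2 : ℂ) • s.bracket (s.o y) (s.o x) := by
  obtain ⟨x0, x1, hx0, hx1, rfl⟩ : ∃ x0 x1, x0 ∈ s.even ∧ x1 ∈ s.odd ∧ x = x0 + x1 :=
    ⟨x - s.o x, s.o x, s.e_mem x, s.o_mem x, by abel⟩
  obtain ⟨y0, y1, hy0, hy1, rfl⟩ : ∃ x0 x1, x0 ∈ s.even ∧ x1 ∈ s.odd ∧ y = x0 + x1 :=
    ⟨y - s.o y, s.o y, s.e_mem y, s.o_mem y, by abel⟩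
  simp only [map_add, LinearMap.add_apply, s.o_even hx0, s.o_even hy0, s.o_odd hx1, s.o_odd hy1,
    zero_add]
  rw [s.skew_e x0 hx0, s.skew_e x0 hx0, s.skew_e y0 hy0 x1, s.symm_oo x1 hx1 y1 hy1]
  module

lemma sig_br (x y : L) : s.sig (s.bracket x y) = s.bracket (s.sig x) (s.sig y) := by
  obtain ⟨x0, x1, hx0, hx1, rfl⟩ : ∃ x0 x1, x0 ∈ s.even ∧ x1 ∈ s.odd ∧ x = x0 + x1 :=
    ⟨x - s.o x, s.o x, s.e_mem x, s.o_mem x, by abel⟩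
  obtain ⟨y0, y1, hy0, hy1, rfl⟩ : ∃ x0 x1, x0 ∈ s.even ∧ x1 ∈ s.odd ∧ y = x0 + x1 :=
    ⟨y - s.o y, s.o y, s.e_mem y, s.o_mem y, by abel⟩
  simp only [map_add, LinearMap.add_apply, s.sig_even hx0, s.sig_even hy0, s.sig_odd hx1,
    s.sig_odd hy1, s.sig_even (s.ee_mem _ hx0 _ hy0), s.sig_odd (s.eo_mem _ hx0 _ hy1),
    s.sig_odd (s.oe_mem _ hx1 _ hy0), s.sig_even (s.oo_mem _ hx1 _ hy1), map_neg,
    LinearMap.neg_apply]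
  abel

lemma sig_of_par {x : L} {p : Bool} (hx : x ∈ s.par p) : s.sig x = (bif p then -1 else 1 : ℂ) • x := by
  cases p <;> simp [par] at *
  exacts [s.sig_even hx, s.sig_odd hx]

/-- transport along a linear equivalence -/
noncomputable def transport {M : Type*} [AddCommGroup M] [Module ℂ M] (e : M ≃ₗ[ℂ] L) :
    SuperLie M where
  even := s.even.comap e.toLinearMap
  odd := s.odd.comap e.toLinearMap
  bracket := (s.bracket.compl₁₂ e.toLinearMap e.toLinearMap).compr₂ e.symm.toLinearMap
  compl := by
    have := (OrderIso.isCompl_iff (Submodule.orderIsoMapComap e).symm (x := s.even) (y := s.odd)).1 s.compl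
    simpa using this
  ee_mem x hx y hy := by simpa using s.ee_mem _ hx _ hy
  eo_mem x hx y hy := by simpa using s.eo_mem _ hx _ hy
  oe_mem x hx y hy := by simpa using s.oe_mem _ hx _ hy
  oo_mem x hx y hy := by simpa using s.oo_mem _ hx _ hy
  skew_e x hx y := by simpa using congrArg e.symm (s.skew_e _ hx (e y))
  symm_oo x hx y hy := by simpa using s.symm_oo _ hx _ hy
  jacobi_e x hx y z := by simpa using congrArg e.symm (s.jacobi_e _ hx (e y) (e z))
  jacobi_oe x hx y hy z := by simpa using congrArg e.symm (s.jacobi_oe _ hx _ hy (e z))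
  jacobi_oo x hx y hy z := by simpa using congrArg e.symm (s.jacobi_oo _ hx _ hy (e z))

end SuperLie

section assoc
variable {R : Type*} [Ring R] [Algebra ℂ R] (τ : R →ₐ[ℂ] R)

/-- odd part in an algebra with involution -/
noncomputable def oddP : R →ₗ[ℂ] R := (2⁻¹ : ℂ) • (LinearMap.id - τ.toLinearMap)

lemma oddP_apply (a : R) : oddP τ a = (2⁻¹ : ℂ) • (a - τ a) := rfl

lemma oddP_even {a : R} (h : τ a = a) : oddP τ a = 0 := by rw [oddP_apply, h]; module
lemma oddP_odd {a : R} (h : τ a = -a) : oddP τ a = a := by rw [oddP_apply, h]; module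

/-- super commutator -/
noncomputable def scomm : R →ₗ[ℂ] R →ₗ[ℂ] R :=
  LinearMap.mul ℂ R - (LinearMap.mul ℂ R).flip +
    (2 : ℂ) • ((LinearMap.mul ℂ R).compl₁₂ (oddP τ) (oddP τ)).flip

lemma scomm_apply (a b : R) : scomm τ a b = a * b - b * a + (2 : ℂ) • (oddP τ b * oddP τ a) := rfl

lemma scomm_e {a : R} (h : τ a = a) (b : R) : scomm τ a b = a * b - b * a := by
  rw [scomm_apply, oddP_even τ h]; simp
lemma scomm_e' {b : R} (h : τ b = b) (a : R) : scomm τ a b = a * b - b * a := by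
  rw [scomm_apply, oddP_even τ h]; simp
lemma scomm_o {a b : R} (h : τ a = -a) (h' : τ b = -b) : scomm τ a b = a * b + b * a := by
  rw [scomm_apply, oddP_odd τ h, oddP_odd τ h']; module

lemma scomm_sum (a b0 b1 : R) : scomm τ a (b0 + b1) = scomm τ a b0 + scomm τ a b1 := map_add _ _ _

lemma split_assoc (hτ : ∀ a, τ (τ a) = a) (a : R) : ∃ a0 a1, τ a0 = a0 ∧ τ a1 = -a1 ∧ a = a0 + a1 := by
  refine ⟨(2⁻¹ : ℂ) • (a + τ a), (2⁻¹ : ℂ) • (a - τ a), ?_, ?_, ?_⟩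
  · simp [hτ, add_comm]
  · simp [hτ, ← smul_neg]
  · module

/-- The super commutator Lie superalgebra. -/
noncomputable def assocSL (hτ : ∀ a, τ (τ a) = a) : SuperLie R where
  even := LinearMap.eqLocus τ.toLinearMap LinearMap.id
  odd := LinearMap.eqLocus τ.toLinearMap (-LinearMap.id)
  bracket := scomm τ
  compl := by
    constructor
    · rw [Submodule.disjoint_def]
      intro x hx hy
      simp [LinearMap.mem_eqLocus] at hx hy
      have : x = -x := hx.symm.trans hy
      exact by
        have h2 : (2 : ℂ) • x = 0 := by rw [two_smul]; nth_rewrite 2 [this]; simp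
        simpa using h2
    · rw [codisjoint_iff, eq_top_iff]
      rintro x -
      obtain ⟨a, b, ha, hb, rfl⟩ := split_assoc τ hτ x
      exact Submodule.add_mem_sup (by simpa using ha) (by simpa using hb)
  ee_mem x hx y hy := by
    simp only [LinearMap.mem_eqLocus, AlgHom.toLinearMap_apply, LinearMap.id_apply, LinearMap.neg_apply] at *
    rw [scomm_e τ hx]; simp [hx, hy]
  eo_mem x hx y hy := by
    simp only [LinearMap.mem_eqLocus, AlgHom.toLinearMap_apply, LinearMap.id_apply, LinearMap.neg_apply] at *
    rw [scomm_e τ hx]; simp [hx, hy]; abel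
  oe_mem x hx y hy := by
    simp only [LinearMap.mem_eqLocus, AlgHom.toLinearMap_apply, LinearMap.id_apply, LinearMap.neg_apply] at *
    rw [scomm_e' τ hy]; simp [hx, hy]; abel
  oo_mem x hx y hy := by
    simp only [LinearMap.mem_eqLocus, AlgHom.toLinearMap_apply, LinearMap.id_apply, LinearMap.neg_apply] at *
    rw [scomm_o τ hx hy]; simp [hx, hy]
  skew_e x hx y := by
    simp only [LinearMap.mem_eqLocus, AlgHom.toLinearMap_apply, LinearMap.id_apply, LinearMap.neg_apply] at *
    rw [scomm_e τ hx, scomm_e' τ hx]; abel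
  symm_oo x hx y hy := by
    simp only [LinearMap.mem_eqLocus, AlgHom.toLinearMap_apply, LinearMap.id_apply, LinearMap.neg_apply] at *
    rw [scomm_o τ hx hy, scomm_o τ hy hx]; abel
  jacobi_e x hx y z := by
    simp only [LinearMap.mem_eqLocus, AlgHom.toLinearMap_apply, LinearMap.id_apply, LinearMap.neg_apply] at *
    simp only [scomm_apply, oddP_apply, LinearMap.sub_apply, LinearMap.add_apply, LinearMap.smul_apply, LinearMap.neg_apply, map_neg, map_zero, map_sub, map_add, map_smul, map_mul, hx, hτ, sub_self, smul_zero, mul_zero, zero_mul, add_zero,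
      mul_add, add_mul, mul_sub, sub_mul, smul_sub, smul_add, mul_assoc, smul_mul_assoc, mul_smul_comm]
    module
  jacobi_oe x hx y hy z := by
    simp only [LinearMap.mem_eqLocus, AlgHom.toLinearMap_apply, LinearMap.id_apply, LinearMap.neg_apply] at *
    simp only [scomm_apply, oddP_apply, LinearMap.sub_apply, LinearMap.add_apply, LinearMap.smul_apply, LinearMap.neg_apply, map_neg, map_zero, map_sub, map_add, map_smul, map_mul, hx, hy, hτ, sub_self, smul_zero, mul_zero, zero_mul, add_zero,
      mul_add, add_mul, mul_sub, sub_mul, smul_sub, smul_add, mul_assoc, smul_mul_assoc, mul_smul_comm, mul_neg, neg_mul, smul_neg, neg_neg]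
    simp only [LinearMap.zero_apply]
    module
  jacobi_oo x hx y hy z := by
    simp only [LinearMap.mem_eqLocus, AlgHom.toLinearMap_apply, LinearMap.id_apply, LinearMap.neg_apply] at *
    simp only [scomm_apply, oddP_apply, LinearMap.sub_apply, LinearMap.add_apply, LinearMap.smul_apply, LinearMap.neg_apply, map_neg, map_zero, map_sub, map_add, map_smul, map_mul, hx, hy, hτ, sub_self, smul_zero, mul_zero, zero_mul, add_zero,
      mul_add, add_mul, mul_sub, sub_mul, smul_sub, smul_add, mul_assoc, smul_mul_assoc, mul_smul_comm, mul_neg, neg_mul, smul_neg, neg_neg]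
    module

variable (hτ : ∀ a, τ (τ a) = a)

lemma assocSL_bracket (a b : R) : (assocSL τ hτ).bracket a b = scomm τ a b := rfl

lemma assocSL_par {p : Bool} {a : R} :
    a ∈ (assocSL τ hτ).par p ↔ τ a = (bif p then -1 else 1 : ℂ) • a := by
  cases p <;> simp [SuperLie.par, assocSL]

lemma assocSL_sc {p q : Bool} {a b : R} (ha : a ∈ (assocSL τ hτ).par p)
    (hb : b ∈ (assocSL τ hτ).par q) : scomm τ a b = a * b - SuperLie.sg p q • (b * a) := by
  rw [assocSL_par] at ha hb
  cases p <;> cases q <;> simp [SuperLie.sg] at *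
  exacts [scomm_e τ ha _, scomm_e τ ha _, scomm_e' τ hb _, scomm_o τ ha hb]

lemma assocSL_o (a : R) : (assocSL τ hτ).o a = oddP τ a := by
  obtain ⟨a0, a1, h0, h1, rfl⟩ := split_assoc τ hτ a
  rw [map_add, map_add, oddP_even τ h0, oddP_odd τ h1, SuperLie.o_even, SuperLie.o_odd]
  · simpa [assocSL] using h1
  · simpa [assocSL] using h0

end assoc
section action

variable {L : Type*} [AddCommGroup L] [Module ℂ L] (s : SuperLie L)
  (V : Submodule ℂ L) (hV : ∀ x ∈ V, s.o x ∈ V)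

/-- odd projection on a graded subspace -/
noncomputable def oV : V →ₗ[ℂ] V := s.o.restrict hV

lemma oV_coe (x : V) : ((oV s V hV x : V) : L) = s.o x := rfl

/-- parity involution of the tensor algebra -/
noncomputable def parT : TensorAlgebra ℂ V →ₐ[ℂ] TensorAlgebra ℂ V :=
  TensorAlgebra.lift ℂ (TensorAlgebra.ι ℂ ∘ₗ (LinearMap.id - (2 : ℂ) • oV s V hV))

lemma parT_ι (x : V) : parT s V hV (TensorAlgebra.ι ℂ x) =
    TensorAlgebra.ι ℂ (x - (2 : ℂ) • oV s V hV x) := by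
  rw [parT, TensorAlgebra.lift_ι_apply]; rfl

lemma oV_oV (x : V) : oV s V hV (oV s V hV x) = oV s V hV x := by
  ext; simp [oV_coe, s.o_o]

lemma parT_parT (w : TensorAlgebra ℂ V) : parT s V hV (parT s V hV w) = w := by
  have : (parT s V hV).comp (parT s V hV) = AlgHom.id ℂ _ := by
    apply TensorAlgebra.hom_ext
    ext x
    simp only [LinearMap.comp_apply, AlgHom.toLinearMap_apply, AlgHom.comp_apply, parT_ι,
      AlgHom.id_apply, map_sub, map_smul, oV_oV]
    module
  exact DFunLike.congr_fun this w

/-- conjugation by the parity involution -/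
noncomputable def tau : Module.End ℂ (TensorAlgebra ℂ V) →ₐ[ℂ] Module.End ℂ (TensorAlgebra ℂ V) :=
  AlgHom.ofLinearMap
    { toFun := fun A => (parT s V hV).toLinearMap ∘ₗ A ∘ₗ (parT s V hV).toLinearMap
      map_add' := by intro A B; ext w; simp
      map_smul' := by intro A B; ext w; simp }
    (by ext w; simp [parT_parT])
    (by intro A B; ext w; simp [parT_parT])

lemma tau_apply (A : Module.End ℂ (TensorAlgebra ℂ V)) (w : TensorAlgebra ℂ V) :
    tau s V hV A w = parT s V hV (A (parT s V hV w)) := rfl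

lemma tau_tau (A : Module.End ℂ (TensorAlgebra ℂ V)) : tau s V hV (tau s V hV A) = A := by
  ext w; simp [tau_apply, parT_parT]

/-- left multiplication -/
noncomputable def lm : TensorAlgebra ℂ V →ₐ[ℂ] Module.End ℂ (TensorAlgebra ℂ V) :=
  Algebra.lmul ℂ _

lemma lm_apply (a w : TensorAlgebra ℂ V) : lm V a w = a * w := rfl

lemma tau_lm (a : TensorAlgebra ℂ V) : tau s V hV (lm V a) = lm V (parT s V hV a) := by
  ext w; simp [tau_apply, lm_apply, parT_parT]

variable (P : L →ₗ[ℂ] V) (Q : L →ₗ[ℂ] L)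

/-- recursion operator -/
noncomputable def Xop : V →ₗ[ℂ] Module.End ℂ (TensorAlgebra ℂ V × (L →ₗ[ℂ] TensorAlgebra ℂ V)) :=
  LinearMap.mk₂ ℂ (fun x wψ =>
    (TensorAlgebra.ι ℂ x * wψ.1,
      LinearMap.mulRight ℂ wψ.1 ∘ₗ TensorAlgebra.ι ℂ ∘ₗ P ∘ₗ s.bracket.flip x
      + wψ.2 ∘ₗ Q ∘ₗ s.bracket.flip x + LinearMap.mulLeft ℂ (TensorAlgebra.ι ℂ x) ∘ₗ wψ.2
      - (2 : ℂ) • (LinearMap.mulLeft ℂ (TensorAlgebra.ι ℂ (oV s V hV x)) ∘ₗ wψ.2 ∘ₗ s.o)))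
    (by
      intro x y w
      refine Prod.ext ?_ (LinearMap.ext fun c => ?_)
      · simp [add_mul]
      · simp [add_mul]; module)
    (by
      intro r x w
      refine Prod.ext ?_ (LinearMap.ext fun c => ?_)
      · simp
      · simp; module)
    (by
      intro x y w
      refine Prod.ext ?_ (LinearMap.ext fun c => ?_)
      · simp [mul_add]
      · simp [mul_add]; module)
    (by
      intro r x w
      refine Prod.ext ?_ (LinearMap.ext fun c => ?_)
      · simp
      · simp; module)

/-- the big representation -/
noncomputable def Phi : TensorAlgebra ℂ V →ₐ[ℂ]
    Module.End ℂ (TensorAlgebra ℂ V × (L →ₗ[ℂ] TensorAlgebra ℂ V)) :=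
  TensorAlgebra.lift ℂ (Xop s V hV P Q)

/-- the action of lowering elements -/
noncomputable def act : L →ₗ[ℂ] Module.End ℂ (TensorAlgebra ℂ V) :=
  LinearMap.flip (LinearMap.snd ℂ _ _ ∘ₗ (Phi s V hV P Q).toLinearMap.flip (1, 0))

lemma act_apply (c : L) (w : TensorAlgebra ℂ V) :
    act s V hV P Q c w = (Phi s V hV P Q w (1, 0)).2 c := rfl

lemma Phi_fst (w : TensorAlgebra ℂ V) : ∀ v, (Phi s V hV P Q w v).1 = w * v.1 := by
  induction w using TensorAlgebra.induction with
  | algebraMap r => intro v; simp [Algebra.algebraMap_eq_smul_one]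
  | ι x => intro v; simp [Phi, Xop]
  | mul a b ha hb => intro v; simp [ha, hb, mul_assoc]
  | add a b ha hb => intro v; simp [ha, hb, add_mul]

lemma act_one (c : L) : act s V hV P Q c 1 = 0 := by simp [act_apply]

lemma act_mul (c : L) (x : V) (w : TensorAlgebra ℂ V) :
    act s V hV P Q c (TensorAlgebra.ι ℂ x * w) =
      TensorAlgebra.ι ℂ (P (s.bracket c x)) * w + act s V hV P Q (Q (s.bracket c x)) w
      + TensorAlgebra.ι ℂ x * act s V hV P Q c w
      - (2 : ℂ) • (TensorAlgebra.ι ℂ (oV s V hV x) * act s V hV P Q (s.o c) w) := by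
  simp only [act_apply, map_mul, Module.End.mul_apply]
  conv_lhs => rw [Phi, TensorAlgebra.lift_ι_apply, ← Phi]
  simp [Xop, Phi_fst]

lemma T_ind (C : TensorAlgebra ℂ V → Prop) (h1 : C 1) (hz : C 0)
    (ha : ∀ a b, C a → C b → C (a + b)) (hs : ∀ (r : ℂ) a, C a → C (r • a))
    (hm : ∀ (x : V) a, C a → C (TensorAlgebra.ι ℂ x * a)) (w) : C w := by
  suffices H : ∀ v, C v → C (w * v) by simpa using H 1 h1
  induction w using TensorAlgebra.induction with
  | algebraMap r => intro v hv; rw [← Algebra.smul_def]; exact hs _ _ hv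
  | ι x => exact hm x
  | mul a b ha hb => intro v hv; rw [mul_assoc]; exact ha _ (hb _ hv)
  | add a b ha' hb => intro v hv; rw [add_mul]; exact ha _ _ (ha' _ hv) (hb _ hv)

variable (hP : ∀ x, ((P (s.sig x) : V) : L) = s.sig (P x)) (hQ : ∀ x, Q (s.sig x) = s.sig (Q x))

lemma sig_o (c : L) : s.sig (s.o c) = s.o (s.sig c) := by
  simp [s.sig_apply, s.o_o]

lemma act_par (hP : ∀ x, ((P (s.sig x) : V) : L) = s.sig (P x))
    (hQ : ∀ x, Q (s.sig x) = s.sig (Q x)) (w : TensorAlgebra ℂ V) : ∀ c,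
    parT s V hV (act s V hV P Q c w) = act s V hV P Q (s.sig c) (parT s V hV w) := by
  induction w using T_ind with
  | h1 => intro c; simp [act_one]
  | hz => intro c; simp
  | ha a b ha hb => intro c; simp [ha, hb]
  | hs r a ha => intro c; simp [ha]
  | hm x a ha =>
    intro c
    have hx : ((x - (2 : ℂ) • oV s V hV x : V) : L) = s.sig x := by
      simp [s.sig_apply, oV_coe]
    have hP' : ∀ y, P (s.sig y) = P y - (2 : ℂ) • oV s V hV (P y) := by
      intro y; ext; rw [hP, s.sig_apply]; simp [oV_coe]
    rw [act_mul, map_mul, parT_ι, act_mul, hx, ← s.sig_br, hP', hQ, ← sig_o, ← ha, ← ha, ← ha]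
    simp only [map_sub, map_add, map_smul, map_mul, parT_ι, oV_oV]

/-- the super Lie algebra of endomorphisms -/
noncomputable def ES : SuperLie (Module.End ℂ (TensorAlgebra ℂ V)) :=
  assocSL (tau s V hV) (tau_tau s V hV)

/-- the candidate map -/
noncomputable def ff : L →ₗ[ℂ] Module.End ℂ (TensorAlgebra ℂ V) :=
  (lm V).toLinearMap ∘ₗ TensorAlgebra.ι ℂ ∘ₗ P + act s V hV P Q ∘ₗ Q

lemma ff_apply (x : L) : ff s V hV P Q x = lm V (TensorAlgebra.ι ℂ (P x)) + act s V hV P Q (Q x) :=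
  rfl

lemma tau_act (hP : ∀ x, ((P (s.sig x) : V) : L) = s.sig (P x))
    (hQ : ∀ x, Q (s.sig x) = s.sig (Q x)) (c : L) :
    tau s V hV (act s V hV P Q c) = act s V hV P Q (s.sig c) := by
  ext1 w
  rw [tau_apply, act_par s V hV P Q hP hQ, parT_parT]

lemma tau_ff (hP : ∀ x, ((P (s.sig x) : V) : L) = s.sig (P x))
    (hQ : ∀ x, Q (s.sig x) = s.sig (Q x)) (c : L) :
    tau s V hV (ff s V hV P Q c) = ff s V hV P Q (s.sig c) := by
  have hP' : ∀ y, P (s.sig y) = P y - (2 : ℂ) • oV s V hV (P y) := by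
      intro y; ext; rw [hP, s.sig_apply]; simp [oV_coe]
  rw [ff_apply, ff_apply, map_add, tau_act s V hV P Q hP hQ, tau_lm, hQ, hP', parT_ι]

lemma ff_par (hP : ∀ x, ((P (s.sig x) : V) : L) = s.sig (P x))
    (hQ : ∀ x, Q (s.sig x) = s.sig (Q x)) {c : L} {p : Bool} (hc : c ∈ s.par p) :
    ff s V hV P Q c ∈ (ES s V hV).par p := by
  rw [ES, assocSL_par, tau_ff s V hV P Q hP hQ, s.sig_of_par hc, map_smul]

lemma ff_o (hP : ∀ x, ((P (s.sig x) : V) : L) = s.sig (P x))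
    (hQ : ∀ x, Q (s.sig x) = s.sig (Q x)) (c : L) :
    (ES s V hV).o (ff s V hV P Q c) = ff s V hV P Q (s.o c) := by
  rw [ES, assocSL_o, oddP_apply, tau_ff s V hV P Q hP hQ, s.o_eq_sig, map_smul, map_sub]

lemma act_lm (hP : ∀ x, ((P (s.sig x) : V) : L) = s.sig (P x))
    (hQ : ∀ x, Q (s.sig x) = s.sig (Q x)) (c : L) (x : V) :
    (ES s V hV).bracket (act s V hV P Q c) (lm V (TensorAlgebra.ι ℂ x)) =
      ff s V hV P Q (s.bracket c x) := by
  have h1 : oddP (tau s V hV) (act s V hV P Q c) = act s V hV P Q (s.o c) := by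
    rw [oddP_apply, tau_act s V hV P Q hP hQ, s.o_eq_sig, map_smul, map_sub]
  have h2 : oddP (tau s V hV) (lm V (TensorAlgebra.ι ℂ x)) =
      lm V (TensorAlgebra.ι ℂ (oV s V hV x)) := by
    rw [oddP_apply, tau_lm, parT_ι, map_sub, map_sub, map_smul, map_smul]; module
  rw [ES, assocSL_bracket, scomm_apply, h1, h2, ff_apply]
  ext1 w
  simp only [LinearMap.sub_apply, LinearMap.add_apply, LinearMap.smul_apply, Module.End.mul_apply,
    lm_apply, act_mul]
  module

lemma Delta_zero {p : Bool} (Δ : Module.End ℂ (TensorAlgebra ℂ V)) (hΔ : Δ ∈ (ES s V hV).par p)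
    (h1 : Δ 1 = 0) (hx : ∀ x : V, (ES s V hV).bracket Δ (lm V (TensorAlgebra.ι ℂ x)) = 0) :
    Δ = 0 := by
  ext1 w
  induction w using T_ind with
  | h1 => simpa using h1
  | hz => simp
  | ha a b ha hb => simp [ha, hb]
  | hs r a ha => simp [ha]
  | hm x a ha =>
    have h := congrArg (fun A => A a) (hx x)
    have hΔ' : ∃ r : ℂ, oddP (tau s V hV) Δ = r • Δ := by
      rw [ES, assocSL_par] at hΔ
      cases p
      · exact ⟨0, by rw [oddP_even _ (by simpa using hΔ)]; simp⟩
      · exact ⟨1, by rw [oddP_odd _ (by simpa using hΔ)]; simp⟩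
    obtain ⟨r, hr⟩ := hΔ'
    simp only [ES, assocSL_bracket, scomm_apply, hr, LinearMap.sub_apply, LinearMap.add_apply,
      LinearMap.smul_apply, Module.End.mul_apply, ha, LinearMap.zero_apply, map_zero, map_smul,
      smul_zero, sub_zero, add_zero, lm_apply] at h
    simpa using h

end action
universe u
namespace CartanDatum

variable {L : Type*} [AddCommGroup L] [Module ℂ L] (D : CartanDatum L)

/-- span of positive simple root spaces -/
def V : Submodule ℂ L := ⨆ i, D.gp i
/-- span of negative simple root spaces -/
def W : Submodule ℂ L := ⨆ i, D.gm i

lemma exists_t : ∃ t ∈ D.hE, ∀ i, D.alpha i t = 1 := by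
  have := D.hfd
  have : FiniteDimensional ℂ D.hE := Submodule.finiteDimensional_of_le (le_sup_left : D.hE ≤ D.hE ⊔ D.hO)
  obtain ⟨φ, hφ⟩ : ∃ φ : Module.Dual ℂ (Module.Dual ℂ D.hE),
      ∀ i, φ ((D.alpha i).domRestrict D.hE) = 1 := by
    let b := Module.Basis.extend D.indep.linearIndepOn_id
    refine ⟨b.constr ℂ (fun _ => (1 : ℂ)), fun i => ?_⟩
    have hi : (D.alpha i).domRestrict D.hE ∈
      D.indep.linearIndepOn_id.extend (Set.subset_univ _) :=
        D.indep.linearIndepOn_id.subset_extend _ ⟨i, rfl⟩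
    have h2 : b ⟨_, hi⟩ = (D.alpha i).domRestrict D.hE := by
      simp [b]
    rw [← h2, Module.Basis.constr_basis]
  refine ⟨(Module.evalEquiv ℂ D.hE).symm φ, Subtype.coe_prop _, fun i => ?_⟩
  have h3 := Module.apply_evalEquiv_symm_apply ℂ D.hE ((D.alpha i).domRestrict D.hE) φ
  rw [hφ] at h3
  exact h3

lemma o_sub {s : SuperLie L} {N : Submodule ℂ L} (h : N = (N ⊓ s.even) ⊔ (N ⊓ s.odd)) :
    ∀ x ∈ N, s.o x ∈ N := by
  intro x hx
  rw [h] at hx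
  obtain ⟨a, ha, b, hb, rfl⟩ := Submodule.mem_sup.1 hx
  rw [map_add, s.o_even ha.2, s.o_odd hb.2, zero_add]
  exact hb.1

lemma o_h : ∀ x ∈ D.h, D.sl.o x ∈ D.h := by
  intro x hx
  obtain ⟨a, ha, b, hb, rfl⟩ := Submodule.mem_sup.1 hx
  rw [map_add, D.sl.o_even (D.hE_le ha), D.sl.o_odd (D.hO_le hb), zero_add]
  exact Submodule.mem_sup_right hb

lemma o_V : ∀ x ∈ D.V, D.sl.o x ∈ D.V := by
  have : D.V ≤ D.V.comap D.sl.o := iSup_le fun i x hx =>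
    Submodule.mem_iSup_of_mem i (o_sub (D.gp_graded i) x hx)
  exact this

lemma o_W : ∀ x ∈ D.W, D.sl.o x ∈ D.W := by
  have : D.W ≤ D.W.comap D.sl.o := iSup_le fun i x hx =>
    Submodule.mem_iSup_of_mem i (o_sub (D.gm_graded i) x hx)
  exact this

lemma hh {a b : L} (ha : a ∈ D.h) (hb : b ∈ D.h) : D.sl.bracket a b ∈ D.h := by
  obtain ⟨a0, ha0, a1, ha1, rfl⟩ := Submodule.mem_sup.1 ha
  obtain ⟨b0, hb0, b1, hb1, rfl⟩ := Submodule.mem_sup.1 hb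
  rw [map_add D.sl.bracket a0 a1, LinearMap.add_apply, D.quasitoral a0 ha0 _ hb, map_add,
    D.sl.skew (p := true) (q := false) (D.hO_le ha1) (D.hE_le hb0),
    D.quasitoral b0 hb0 _ (Submodule.mem_sup_right ha1)]
  simp only [smul_zero, neg_zero, zero_add]
  exact Submodule.mem_sup_left (D.brOO _ ha1 _ hb1)

lemma hV {a b : L} (ha : a ∈ D.h) (hb : b ∈ D.V) : D.sl.bracket a b ∈ D.V := by
  have : D.V ≤ D.V.comap (D.sl.bracket a) := iSup_le fun i x hx =>
    Submodule.mem_iSup_of_mem i (D.gp_mod i a ha x hx)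
  exact this hb

lemma hW {a b : L} (ha : a ∈ D.h) (hb : b ∈ D.W) : D.sl.bracket a b ∈ D.W := by
  have : D.W ≤ D.W.comap (D.sl.bracket a) := iSup_le fun i x hx =>
    Submodule.mem_iSup_of_mem i (D.gm_mod i a ha x hx)
  exact this hb

lemma VW {a b : L} (ha : a ∈ D.V) (hb : b ∈ D.W) : D.sl.bracket a b ∈ D.h := by
  have : D.W ≤ D.h.comap (D.sl.bracket a) := iSup_le fun j y hy => by
    have : D.V ≤ D.h.comap (D.sl.bracket.flip y) := iSup_le fun i x hx => by
      by_cases hij : i = j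
      · subst hij; exact D.pair_mem i x hx y hy
      · simp only [Submodule.mem_comap, LinearMap.flip_apply, D.pair_ne i j hij x hx y hy]
        exact zero_mem _
    exact this ha
  exact this hb

lemma WV {a b : L} (ha : a ∈ D.W) (hb : b ∈ D.V) : D.sl.bracket a b ∈ D.h := by
  rw [D.sl.skew_gen]
  exact add_mem (neg_mem (D.VW hb ha)) (Submodule.smul_mem _ _ (D.VW (D.o_V _ hb) (D.o_W _ ha)))

lemma t_V {t : L} (ht : t ∈ D.hE) (h1 : ∀ i, D.alpha i t = 1) {x : L} (hx : x ∈ D.V) :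
    D.sl.bracket t x = x := by
  have : D.V ≤ LinearMap.eqLocus (D.sl.bracket t) LinearMap.id := iSup_le fun i x hx => by
    simp [LinearMap.mem_eqLocus, D.gp_wt i t ht x hx, h1]
  exact this hx

lemma t_W {t : L} (ht : t ∈ D.hE) (h1 : ∀ i, D.alpha i t = 1) {x : L} (hx : x ∈ D.W) :
    D.sl.bracket t x = -x := by
  have : D.W ≤ LinearMap.eqLocus (D.sl.bracket t) (-LinearMap.id) := iSup_le fun i x hx => by
    simp [LinearMap.mem_eqLocus, D.gm_wt i t ht x hx, h1]
  exact this hx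

lemma disj : Disjoint D.V (D.h ⊔ D.W) := by
  obtain ⟨t, ht, h1⟩ := D.exists_t
  rw [Submodule.disjoint_def]
  intro x hx hx'
  obtain ⟨a, ha, b, hb, rfl⟩ := Submodule.mem_sup.1 hx'
  have e1 := D.t_V ht h1 hx
  rw [map_add, D.quasitoral t ht a ha, D.t_W ht h1 hb, zero_add] at e1
  have e2 : D.sl.bracket t (-b) = -b := by rw [e1]; exact D.t_V ht h1 hx
  rw [map_neg, D.t_W ht h1 hb, neg_neg] at e2
  have : (2 : ℂ) • b = 0 := by rw [two_smul]; nth_rewrite 1 [e2]; simp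
  have hb0 : b = 0 := by simpa using this
  rw [← e1, hb0, neg_zero]

lemma exists_PQ : ∃ (P : L →ₗ[ℂ] D.V) (Q : L →ₗ[ℂ] L),
    (∀ x : D.V, P x = x) ∧ (∀ x ∈ D.V, Q x = 0) ∧ (∀ x ∈ D.h ⊔ D.W, P x = 0) ∧
    (∀ x ∈ D.h ⊔ D.W, Q x = x) ∧
    (∀ x, ((P (D.sl.sig x) : D.V) : L) = D.sl.sig (P x)) ∧
    (∀ x, Q (D.sl.sig x) = D.sl.sig (Q x)) := by
  obtain ⟨B', hB', hc⟩ := D.disj.symm.exists_isCompl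
  have sV : ∀ x ∈ D.V, D.sl.sig x ∈ D.V := fun x hx =>
    sub_mem hx (Submodule.smul_mem _ _ (D.o_V x hx))
  have sB : ∀ x ∈ D.h ⊔ D.W, D.sl.sig x ∈ D.h ⊔ D.W := by
    intro x hx
    refine sub_mem hx (Submodule.smul_mem _ _ ?_)
    obtain ⟨a, ha, b, hb, rfl⟩ := Submodule.mem_sup.1 hx
    show D.sl.o (a + b) ∈ _
    rw [map_add]
    exact Submodule.add_mem_sup (D.o_h a ha) (D.o_W b hb)
  let P0 : L →ₗ[ℂ] L := D.V.projection B' hc.symm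
  have hP0 : ∀ x, P0 x ∈ D.V := fun x => Submodule.projection_apply_mem _ x
  have hP0V : ∀ x ∈ D.V, P0 x = x := fun x hx => Submodule.projection_apply_of_mem_left _ hx
  have hP0B : ∀ x ∈ D.h ⊔ D.W, P0 x = 0 := fun x hx =>
    (Submodule.projection_apply_eq_zero_iff _).2 (hB' hx)
  let P1 : L →ₗ[ℂ] L := (2⁻¹ : ℂ) • (P0 + D.sl.sig ∘ₗ P0 ∘ₗ D.sl.sig)
  have P1a : ∀ x, P1 x = (2⁻¹ : ℂ) • (P0 x + D.sl.sig (P0 (D.sl.sig x))) := fun x => rfl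
  have hP1 : ∀ x, P1 x ∈ D.V := fun x =>
    Submodule.smul_mem _ _ (add_mem (hP0 _) (sV _ (hP0 _)))
  have hP1V : ∀ x ∈ D.V, P1 x = x := fun x hx => by
    rw [P1a, hP0V x hx, hP0V _ (sV x hx), D.sl.sig_sig]; module
  have hP1B : ∀ x ∈ D.h ⊔ D.W, P1 x = 0 := fun x hx => by
    rw [P1a, hP0B x hx, hP0B _ (sB x hx)]; simp
  have hP1s : ∀ x, P1 (D.sl.sig x) = D.sl.sig (P1 x) := fun x => by
    rw [P1a, P1a, D.sl.sig_sig, map_smul, map_add, D.sl.sig_sig, add_comm]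
  refine ⟨P1.codRestrict D.V hP1, LinearMap.id - P1, fun x => Subtype.ext (hP1V x x.2),
    fun x hx => ?_, fun x hx => Subtype.ext (hP1B x hx), fun x hx => ?_, hP1s, fun x => ?_⟩
  · simp [hP1V x hx]
  · simp [hP1B x hx]
  · simp [hP1s]

lemma presented_zero {L : Type} [AddCommGroup L] [Module ℂ L] (D : CartanDatum L)
    (hpres : Presented.{0, u} D) : Presented.{0, 0} D := by
  intro M _ _ sM f h1 h2 h3 h4 h5 h6 h7
  let e : ULift.{u} M ≃ₗ[ℂ] M := ULift.moduleEquiv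
  let sM' := sM.transport e
  have hb : ∀ a b, sM'.bracket a b = e.symm (sM.bracket (e a) (e b)) := fun _ _ => rfl
  have he : ∀ a, a ∈ sM'.even ↔ e a ∈ sM.even := fun _ => Iff.rfl
  have ho : ∀ a, a ∈ sM'.odd ↔ e a ∈ sM.odd := fun _ => Iff.rfl
  obtain ⟨F, ⟨hF1, hF2, hF3, hF4⟩, hu⟩ := hpres (ULift.{u} M) sM' (e.symm.toLinearMap ∘ₗ f)
    (fun a ha b hb' => by simp [hb, h1 a ha b hb'])
    (fun i a ha b hb' => by simp [hb, h2 i a ha b hb'])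
    (fun i a ha b hb' => by simp [hb, h3 i a ha b hb'])
    (fun i a ha b hb' => by simp [hb, h4 i a ha b hb'])
    (fun i j hij a ha b hb' => by simp [hb, h5 i j hij a ha b hb'])
    (fun v hv hv' => by simpa [he] using h6 v hv hv')
    (fun v hv hv' => by simpa [ho] using h7 v hv hv')
  refine ⟨e.toLinearMap ∘ₗ F, ⟨fun a b => by simp [hF1, hb], hF2, hF3,
    fun v hv => by simp [hF4 v hv]⟩, ?_⟩
  rintro G ⟨hG1, hG2, hG3, hG4⟩
  have := hu (e.symm.toLinearMap ∘ₗ G) ⟨fun a b => by simp [hb, hG1],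
    fun v hv => by simpa [he] using hG2 v hv, fun v hv => by simpa [ho] using hG3 v hv,
    fun v hv => by simp [hG4 v hv]⟩
  rw [← this]; ext; simp

lemma exists_hom {L : Type} [AddCommGroup L] [Module ℂ L] (D : CartanDatum L)
    (hpres : Presented.{0, 0} D) :
    ∃ F : L →ₗ[ℂ] Module.End ℂ (TensorAlgebra ℂ D.V),
      (∀ a b, F (D.sl.bracket a b) = (ES D.sl D.V D.o_V).bracket (F a) (F b)) ∧
      (∀ p, ∀ v ∈ D.sl.par p, F v ∈ (ES D.sl D.V D.o_V).par p) ∧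
      (∀ x : D.V, F x = lm D.V (TensorAlgebra.ι ℂ x)) := by
  obtain ⟨P, Q, hPV, hQV, hPB, hQB, hPs, hQs⟩ := D.exists_PQ
  set E := ES D.sl D.V D.o_V with hE
  let f := ff D.sl D.V D.o_V P Q
  have fV : ∀ x : D.V, f x = lm D.V (TensorAlgebra.ι ℂ x) := fun x => by
    simp only [f, ff_apply, hPV, hQV _ x.2, map_zero, add_zero]
  have fB : ∀ x ∈ D.h ⊔ D.W, f x = act D.sl D.V D.o_V P Q x := fun x hx => by
    simp only [f, ff_apply, hPB x hx, hQB x hx, map_zero, zero_add]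
  have fpar : ∀ p, ∀ v ∈ D.sl.par p, f v ∈ E.par p := fun p v hv => ff_par _ _ _ _ _ hPs hQs hv
  have fo : ∀ v, E.o (f v) = f (D.sl.o v) := fun v => ff_o _ _ _ _ _ hPs hQs v
  -- B acts on V
  have BV : ∀ c ∈ D.h ⊔ D.W, ∀ x ∈ D.V, f (D.sl.bracket c x) = E.bracket (f c) (f x) := by
    intro c hc x hx
    rw [fB c hc, fV ⟨x, hx⟩, act_lm _ _ _ _ _ hPs hQs]
  have VW' : ∀ x ∈ D.V, ∀ y ∈ D.W, f (D.sl.bracket x y) = E.bracket (f x) (f y) := by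
    intro x hx y hy
    rw [D.sl.skew_gen, E.skew_gen, fo, fo, map_add, map_neg, map_smul,
      BV y (Submodule.mem_sup_right hy) x hx,
      BV _ (Submodule.mem_sup_right (D.o_W y hy)) _ (D.o_V x hx)]
  have oB : ∀ x ∈ D.h ⊔ D.W, D.sl.o x ∈ D.h ⊔ D.W := by
    intro x hx
    obtain ⟨a, ha, b, hb, rfl⟩ := Submodule.mem_sup.1 hx
    rw [map_add]
    exact Submodule.add_mem_sup (D.o_h a ha) (D.o_W b hb)
  have hB : ∀ a ∈ D.h, ∀ b ∈ D.h ⊔ D.W, D.sl.bracket a b ∈ D.h ⊔ D.W := by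
    intro a ha b hb
    obtain ⟨c, hc, d, hd, rfl⟩ := Submodule.mem_sup.1 hb
    rw [map_add]
    exact Submodule.add_mem_sup (D.hh ha hc) (D.hW ha hd)
  have f1 : ∀ x ∈ D.h ⊔ D.W, f x 1 = 0 := fun x hx => by rw [fB x hx, act_one]
  have key : ∀ p q a b, a ∈ D.h → a ∈ D.sl.par p → b ∈ D.h ⊔ D.W → b ∈ D.sl.par q →
      (∀ x ∈ D.V, f (D.sl.bracket a (D.sl.bracket b x)) =
        E.bracket (f a) (f (D.sl.bracket b x))) →
      f (D.sl.bracket a b) = E.bracket (f a) (f b) := by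
    intro p q a b ha hap hb hbq hyp
    rw [← sub_eq_zero]
    refine Delta_zero D.sl D.V D.o_V (p := xor p q) _ (sub_mem (fpar _ _ (D.sl.br_mem hap hbq))
      (E.br_mem (fpar _ _ hap) (fpar _ _ hbq))) ?_ ?_
    · rw [LinearMap.sub_apply, f1 _ (hB a ha b hb), hE, ES, assocSL_bracket,
        scomm_apply, ← assocSL_o _ (tau_tau _ _ _), ← assocSL_o _ (tau_tau _ _ _), ← ES, ← hE, fo, fo]
      simp [f1 a (Submodule.mem_sup_left ha), f1 b hb, f1 _ (oB b hb),
        f1 _ (oB a (Submodule.mem_sup_left ha))]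
    · intro x
      rw [← fV, ← hE, map_sub, LinearMap.sub_apply, ← BV _ (hB a ha b hb) x x.2]
      have j1 := D.sl.jac hap hbq (x : L)
      have j2 := E.jac (fpar _ _ hap) (fpar _ _ hbq) (f x)
      rw [← BV b hb x x.2, ← BV a (Submodule.mem_sup_left ha) x x.2, ← hyp x x.2,
        ← BV b hb _ (D.hV ha x.2)] at j2
      rw [j1, map_add, map_smul] at j2
      rw [sub_eq_zero]
      exact add_right_cancel j2
  have split : ∀ (N : Submodule ℂ L), (∀ x ∈ N, D.sl.o x ∈ N) → ∀ x ∈ N,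
      ∃ x0 x1, x0 ∈ N ∧ x0 ∈ D.sl.par false ∧ x1 ∈ N ∧ x1 ∈ D.sl.par true ∧ x = x0 + x1 :=
    fun N hN x hx => ⟨x - D.sl.o x, D.sl.o x, sub_mem hx (hN x hx), D.sl.e_mem x, hN x hx,
      D.sl.o_mem x, by abel⟩
  have rel_hh : ∀ a ∈ D.h, ∀ b ∈ D.h, f (D.sl.bracket a b) = E.bracket (f a) (f b) := by
    have k : ∀ p q a b, a ∈ D.h → a ∈ D.sl.par p → b ∈ D.h → b ∈ D.sl.par q →
        f (D.sl.bracket a b) = E.bracket (f a) (f b) := fun p q a b ha hap hb hbq =>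
      key p q a b ha hap (Submodule.mem_sup_left hb) hbq fun x hx =>
        BV a (Submodule.mem_sup_left ha) _ (D.hV hb hx)
    intro a ha b hb
    obtain ⟨a0, a1, ha0, ha0', ha1, ha1', rfl⟩ := split D.h D.o_h a ha
    obtain ⟨b0, b1, hb0, hb0', hb1, hb1', rfl⟩ := split D.h D.o_h b hb
    simp only [map_add, LinearMap.add_apply, k _ _ _ _ ha0 ha0' hb0 hb0',
      k _ _ _ _ ha0 ha0' hb1 hb1', k _ _ _ _ ha1 ha1' hb0 hb0', k _ _ _ _ ha1 ha1' hb1 hb1']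
  have rel_hW : ∀ a ∈ D.h, ∀ b ∈ D.W, f (D.sl.bracket a b) = E.bracket (f a) (f b) := by
    have k : ∀ p q a b, a ∈ D.h → a ∈ D.sl.par p → b ∈ D.W → b ∈ D.sl.par q →
        f (D.sl.bracket a b) = E.bracket (f a) (f b) := fun p q a b ha hap hb hbq =>
      key p q a b ha hap (Submodule.mem_sup_right hb) hbq fun x hx =>
        rel_hh a ha _ (D.WV hb hx)
    intro a ha b hb
    obtain ⟨a0, a1, ha0, ha0', ha1, ha1', rfl⟩ := split D.h D.o_h a ha
    obtain ⟨b0, b1, hb0, hb0', hb1, hb1', rfl⟩ := split D.W D.o_W b hb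
    simp only [map_add, LinearMap.add_apply, k _ _ _ _ ha0 ha0' hb0 hb0',
      k _ _ _ _ ha0 ha0' hb1 hb1', k _ _ _ _ ha1 ha1' hb0 hb0', k _ _ _ _ ha1 ha1' hb1 hb1']
  have iV : ∀ i, ∀ v ∈ D.gp i, v ∈ D.V := fun i v hv => Submodule.mem_iSup_of_mem i hv
  have iW : ∀ i, ∀ v ∈ D.gm i, v ∈ D.W := fun i v hv => Submodule.mem_iSup_of_mem i hv
  obtain ⟨F, ⟨hF1, hF2, hF3, hF4⟩, -⟩ := hpres _ E f rel_hh
    (fun i a ha b hb => BV a (Submodule.mem_sup_left ha) b (iV i b hb))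
    (fun i a ha b hb => rel_hW a ha b (iW i b hb))
    (fun i a ha b hb => VW' a (iV i a ha) b (iW i b hb))
    (fun i j hij a ha b hb => by
      rw [← VW' a (iV i a ha) b (iW j b hb), D.pair_ne i j hij a ha b hb, map_zero])
    (fun v _ hv => fpar false v hv)
    (fun v _ hv => fpar true v hv)
  refine ⟨F, hF1, fun p => ?_, fun x => ?_⟩
  · cases p
    · exact hF2
    · exact hF3
  · rw [hF4 x (Submodule.mem_sup_right (Submodule.mem_sup_left x.2)), fV]

end CartanDatum
section final

variable {L : Type} [AddCommGroup L] [Module ℂ L] (D : CartanDatum L)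
  {M : Type} [AddCommGroup M] [Module ℂ M] (sM : SuperLie M) (f : L →ₗ[ℂ] M)

/-- graded graph of the free extension -/
inductive Wd : ℕ → Bool → L → M → Prop
  | gen (p : Bool) (x : L) (hx : x ∈ D.V) (hp : x ∈ D.sl.par p) : Wd 1 p x (f x)
  | zero (n : ℕ) (hn : 0 < n) (p : Bool) : Wd n p 0 0
  | add {n p u m u' m'} : Wd n p u m → Wd n p u' m' → Wd n p (u + u') (m + m')
  | smul {n p u m} (r : ℂ) : Wd n p u m → Wd n p (r • u) (r • m)
  | br {n p u m n' p' u' m'} : Wd n p u m → Wd n' p' u' m' →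
      Wd (n + n') (xor p p') (D.sl.bracket u u') (sM.bracket m m')

/-- the operator of a generator on `M × ℂ` -/
noncomputable def rop : D.V →ₗ[ℂ] Module.End ℂ (M × ℂ) :=
  LinearMap.mk₂ ℂ (fun x mc => (sM.bracket (f x) mc.1 + mc.2 • f x, 0))
    (by intro x y w; ext <;> simp; module)
    (by intro r x w; ext <;> simp; module)
    (by intro r x w; ext <;> simp; module)
    (by intro r x w; ext <;> simp; module)

/-- the representation on `M × ℂ` -/
noncomputable def rho : TensorAlgebra ℂ D.V →ₐ[ℂ] Module.End ℂ (M × ℂ) :=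
  TensorAlgebra.lift ℂ (rop D sM f)

lemma rho_ι (x : D.V) (mc : M × ℂ) :
    rho D sM f (TensorAlgebra.ι ℂ x) mc = (sM.bracket (f x) mc.1 + mc.2 • f x, 0) := by
  rw [rho, TensorAlgebra.lift_ι_apply]; rfl

variable {D sM f}

lemma V_le_Np : D.V ≤ D.Np := le_sInf fun _ hN => hN.1

lemma Np_br {x y : L} (hx : x ∈ D.Np) (hy : y ∈ D.Np) : D.sl.bracket x y ∈ D.Np := by
  simp only [CartanDatum.Np, lieSpan, Submodule.mem_sInf] at *
  exact fun N hN => hN.2 _ (hx N hN) _ (hy N hN)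

lemma Np_le {N : Submodule ℂ L} (h1 : D.V ≤ N) (h2 : ∀ x ∈ N, ∀ y ∈ N, D.sl.bracket x y ∈ N) :
    D.Np ≤ N := sInf_le ⟨h1, h2⟩

lemma Wd.pos {n p u m} (h : Wd D sM f n p u m) : 0 < n := by
  induction h <;> omega

lemma Wd.np {n p u m} (h : Wd D sM f n p u m) : u ∈ D.Np := by
  induction h with
  | gen p x hx hp => exact V_le_Np hx
  | zero n hn p => exact zero_mem _
  | add _ _ h1 h2 => exact add_mem h1 h2
  | smul r _ h => exact Submodule.smul_mem _ _ h
  | br _ _ h1 h2 => exact Np_br h1 h2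

lemma Wd.parL {n p u m} (h : Wd D sM f n p u m) : u ∈ D.sl.par p := by
  induction h with
  | gen p x hx hp => exact hp
  | zero n hn p => exact zero_mem _
  | add _ _ h1 h2 => exact add_mem h1 h2
  | smul r _ h => exact Submodule.smul_mem _ _ h
  | br _ _ h1 h2 => exact D.sl.br_mem h1 h2

lemma Wd.parM (hf : ∀ p, ∀ x ∈ D.V, x ∈ D.sl.par p → f x ∈ sM.par p)
    {n p u m} (h : Wd D sM f n p u m) : m ∈ sM.par p := by
  induction h with
  | gen p x hx hp => exact hf p x hx hp
  | zero n hn p => exact zero_mem _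
  | add _ _ h1 h2 => exact add_mem h1 h2
  | smul r _ h => exact Submodule.smul_mem _ _ h
  | br _ _ h1 h2 => exact sM.br_mem h1 h2

lemma Wd.deg {t : L} (ht : t ∈ D.hE) (h1 : ∀ i, D.alpha i t = 1)
    {n p u m} (h : Wd D sM f n p u m) : D.sl.bracket t u = (n : ℂ) • u := by
  induction h with
  | gen p x hx hp => simp [D.t_V ht h1 hx]
  | zero n hn p => simp
  | add _ _ h1 h2 => simp [h1, h2]
  | smul r _ h => rw [map_smul, h, smul_comm]
  | br _ _ h1 h2 =>
    rw [D.sl.jacobi_e t (D.hE_le ht), h1, h2]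
    simp [add_smul]

lemma Wd.rep (F : L →ₗ[ℂ] Module.End ℂ (TensorAlgebra ℂ D.V))
    (hF1 : ∀ a b, F (D.sl.bracket a b) = (ES D.sl D.V D.o_V).bracket (F a) (F b))
    (hF2 : ∀ p, ∀ v ∈ D.sl.par p, F v ∈ (ES D.sl D.V D.o_V).par p)
    (hF3 : ∀ x : D.V, F x = lm D.V (TensorAlgebra.ι ℂ x))
    (hf : ∀ p, ∀ x ∈ D.V, x ∈ D.sl.par p → f x ∈ sM.par p)
    {n p u m} (h : Wd D sM f n p u m) : ∃ w, F u = lm D.V w ∧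
      ∀ m' c, rho D sM f w (m', c) = (sM.bracket m m' + c • (n : ℂ) • m, 0) := by
  induction h with
  | gen p x hx hp => exact ⟨_, hF3 ⟨x, hx⟩, fun m' c => by simp [rho_ι]⟩
  | zero n hn p => exact ⟨0, by simp, fun m' c => by ext <;> simp⟩
  | add _ _ h1 h2 =>
    obtain ⟨w, h1, h1'⟩ := h1
    obtain ⟨v, h2, h2'⟩ := h2
    refine ⟨w + v, by simp [h1, h2], fun m' c => ?_⟩
    rw [map_add, LinearMap.add_apply, h1', h2']
    ext <;> simp
    abel
  | smul r _ h =>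
    obtain ⟨w, h1, h1'⟩ := h
    refine ⟨r • w, by simp [h1], fun m' c => ?_⟩
    rw [map_smul, LinearMap.smul_apply, h1']
    ext <;> simp
    module
  | @br n p u m n' p' u' m' hu hu' h1 h2 =>
    obtain ⟨w, h1, h1'⟩ := h1
    obtain ⟨v, h2, h2'⟩ := h2
    refine ⟨w * v - SuperLie.sg p p' • (v * w), ?_, fun m'' c => ?_⟩
    · rw [hF1, ES, assocSL_bracket, assocSL_sc _ (tau_tau _ _ _) (hF2 _ _ hu.parL)
        (hF2 _ _ hu'.parL), h1, h2]
      simp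
    · have j := sM.jac (hu.parM hf) (hu'.parM hf) m''
      have k := sM.skew (hu.parM hf) (hu'.parM hf)
      rw [map_sub, map_smul, map_mul, map_mul, LinearMap.sub_apply, LinearMap.smul_apply,
        Module.End.mul_apply, Module.End.mul_apply, h1', h2', h1', h2']
      ext
      · simp only [map_add, map_smul, j, zero_smul, add_zero, Prod.fst_sub, Prod.smul_fst,
          Nat.cast_add]
        have k' : SuperLie.sg p p' • sM.bracket m' m = - sM.bracket m m' := by rw [k, neg_neg]
        have : SuperLie.sg p p' • c • (n : ℂ) • sM.bracket m' m = -(c • (n : ℂ) • sM.bracket m m') := by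
          rw [smul_comm, smul_comm (SuperLie.sg p p'), k']; simp
        rw [smul_add, this]
        module
      · simp

/-- graph pieces -/
def Gp (D : CartanDatum L) (sM : SuperLie M) (f : L →ₗ[ℂ] M) (np : ℕ × Bool) :
    Submodule ℂ (L × M) where
  carrier := {g | Wd D sM f (np.1 + 1) np.2 g.1 g.2}
  zero_mem' := Wd.zero _ (Nat.succ_pos _) _
  add_mem' h1 h2 := Wd.add h1 h2
  smul_mem' r _ h := Wd.smul r h

lemma mem_Gp {np : ℕ × Bool} {g : L × M} :
    g ∈ Gp D sM f np ↔ Wd D sM f (np.1 + 1) np.2 g.1 g.2 := Iff.rfl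

lemma Wd.mem {n p u m} (h : Wd D sM f n p u m) : (u, m) ∈ ⨆ np, Gp D sM f np := by
  refine Submodule.mem_iSup_of_mem (n - 1, p) ?_
  rw [mem_Gp]
  have := h.pos
  simpa [Nat.sub_add_cancel this] using h

lemma G_inj (t : L) (ht : t ∈ D.hE) (h1 : ∀ i, D.alpha i t = 1)
    (hinj : ∀ n p m, Wd D sM f n p 0 m → m = 0) {g : L × M}
    (hg : g ∈ ⨆ np, Gp D sM f np) (hg0 : g.1 = 0) : g.2 = 0 := by
  obtain ⟨φ, hφ, rfl⟩ := (Submodule.mem_iSup_iff_exists_finsupp _ _).1 hg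
  let A : Module.End ℂ L := D.sl.bracket t + (2⁻¹ : ℂ) • D.sl.o
  let e : ℕ × Bool → ℂ := fun np => ((np.1 + 1 : ℕ) : ℂ) + bif np.2 then 2⁻¹ else 0
  have he : Function.Injective e := by
    have h2 : ∀ np, (2 : ℂ) * e np = ((2 * (np.1 + 1) + bif np.2 then 1 else 0 : ℕ) : ℂ) := by
      rintro ⟨n, p⟩; cases p <;> simp [e]; ring
    rintro ⟨n, p⟩ ⟨n', p'⟩ h
    have h3 := congrArg (fun z => (2 : ℂ) * z) h
    simp only [h2] at h3
    have h4 := Nat.cast_injective (R := ℂ) h3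
    cases p <;> cases p' <;> simp at h4 ⊢ <;> omega
  have hind := (Module.End.eigenspaces_iSupIndep A).comp he
  rw [iSupIndep_iff_finsetSum_eq_zero_imp_eq_zero] at hind
  have hz : ∀ i ∈ φ.support, (φ i).1 = 0 := by
    refine hind φ.support (fun i => (φ i).1) (fun i _ => ?_) ?_
    · have h := mem_Gp.1 (hφ i)
      rw [Function.comp_apply, Module.End.mem_eigenspace_iff]
      have hp := h.parL
      have hd := h.deg ht h1
      obtain ⟨n, p⟩ := i
      simp only [A, e, LinearMap.add_apply, LinearMap.smul_apply, hd, add_smul]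
      cases p
      · rw [D.sl.o_even hp]; simp
      · rw [D.sl.o_odd hp]; simp
    · rw [← hg0, Finsupp.sum, Prod.fst_sum]
  rw [Finsupp.sum, Prod.snd_sum]
  refine Finset.sum_eq_zero fun i hi => ?_
  have h := mem_Gp.1 (hφ i)
  rw [hz i hi] at h
  exact hinj _ _ _ h

lemma G_br {g g' : L × M} (hg : g ∈ ⨆ np, Gp D sM f np) (hg' : g' ∈ ⨆ np, Gp D sM f np) :
    (D.sl.bracket g.1 g'.1, sM.bracket g.2 g'.2) ∈ ⨆ np, Gp D sM f np := by
  induction hg using Submodule.iSup_induction' with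
  | mem i x hx =>
    induction hg' using Submodule.iSup_induction' with
    | mem j y hy => exact (Wd.br hx hy).mem
    | zero => simp; exact zero_mem (⨆ np, Gp D sM f np)
    | add y y' _ _ h1 h2 => simpa using add_mem h1 h2
  | zero => simp; exact zero_mem (⨆ np, Gp D sM f np)
  | add y y' _ _ h1 h2 => simpa using add_mem h1 h2

lemma G_fst : (⨆ np, Gp D sM f np).map (LinearMap.fst ℂ L M) = D.Np := by
  apply le_antisymm
  · rw [Submodule.map_le_iff_le_comap]
    exact iSup_le fun i g hg => (mem_Gp.1 hg).np
  · apply Np_le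
    · intro x hx
      have h0 := (Wd.gen (D := D) (sM := sM) (f := f) false (x - D.sl.o x)
        (sub_mem hx (D.o_V x hx)) (D.sl.e_mem x)).mem
      have h1 := (Wd.gen (D := D) (sM := sM) (f := f) true (D.sl.o x) (D.o_V x hx) (D.sl.o_mem x)).mem
      exact ⟨_, add_mem h0 h1, by simp⟩
    · rintro _ ⟨g, hg, rfl⟩ _ ⟨g', hg', rfl⟩
      exact ⟨_, G_br hg hg', rfl⟩

lemma G_gen {x : L} (hx : x ∈ D.V) : (x, f x) ∈ ⨆ np, Gp D sM f np := by
  have h0 := (Wd.gen (D := D) (sM := sM) (f := f) false (x - D.sl.o x)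
    (sub_mem hx (D.o_V x hx)) (D.sl.e_mem x)).mem
  have h1 := (Wd.gen (D := D) (sM := sM) (f := f) true (D.sl.o x) (D.o_V x hx) (D.sl.o_mem x)).mem
  have := add_mem h0 h1
  simpa using this

lemma G_split (hf : ∀ p, ∀ x ∈ D.V, x ∈ D.sl.par p → f x ∈ sM.par p) {g : L × M}
    (hg : g ∈ ⨆ np, Gp D sM f np) : ∃ g0 g1, g0 ∈ (⨆ np, Gp D sM f np) ∧
      g1 ∈ (⨆ np, Gp D sM f np) ∧ g0.1 ∈ D.sl.even ∧ g0.2 ∈ sM.even ∧ g1.1 ∈ D.sl.odd ∧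
      g1.2 ∈ sM.odd ∧ g = g0 + g1 := by
  induction hg using Submodule.iSup_induction' with
  | mem i x hx =>
    have h := mem_Gp.1 hx
    have a := h.parL
    have b := h.parM hf
    obtain ⟨n, p⟩ := i
    have hx' := Submodule.mem_iSup_of_mem (p := Gp D sM f) _ hx
    cases p
    · exact ⟨x, 0, hx', zero_mem _, a, b, zero_mem _, zero_mem _, by simp⟩
    · exact ⟨0, x, zero_mem _, hx', zero_mem _, zero_mem _, a, b, by simp⟩
  | zero => exact ⟨0, 0, zero_mem _, zero_mem _, zero_mem _, zero_mem _, zero_mem _, zero_mem _,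
      by simp⟩
  | add y y' _ _ ih1 ih2 =>
    obtain ⟨a0, a1, h1, h2, h3, h4, h5, h6, rfl⟩ := ih1
    obtain ⟨b0, b1, k1, k2, k3, k4, k5, k6, rfl⟩ := ih2
    exact ⟨a0 + b0, a1 + b1, add_mem h1 k1, add_mem h2 k2, add_mem h3 k3, add_mem h4 k4,
      add_mem h5 k5, add_mem h6 k6, by abel⟩

end final

/-- In `𝔤̃(𝒜)` (axiomatized by the universal property `D.Presented`), the
positive part `𝔫̃⁺` is *freely generated*, as a Lie superalgebra, by the super vector space
`⊕ᵢ 𝔤_{α_i}`: every parity-preserving linear assignment on the `𝔤_{α_i}` with values in a Lie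
superalgebra `M` extends uniquely to a parity- and bracket-preserving linear map on `𝔫̃⁺`. -/
theorem gtilde_np_free
    {L : Type} [AddCommGroup L] [Module ℂ L] (D : CartanDatum L)
    (hpres : D.Presented)
    (M : Type) [AddCommGroup M] [Module ℂ M] (sM : SuperLie M)
    (f : L →ₗ[ℂ] M)
    (hfpar : ∀ i, ∀ v ∈ D.gp i,
      (v ∈ D.sl.even → f v ∈ sM.even) ∧ (v ∈ D.sl.odd → f v ∈ sM.odd)) :
    ∃! F : ↥D.Np →ₗ[ℂ] M,
      (∀ (a b : L) (ha : a ∈ D.Np) (hb : b ∈ D.Np) (hab : D.sl.bracket a b ∈ D.Np),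
        F ⟨D.sl.bracket a b, hab⟩ = sM.bracket (F ⟨a, ha⟩) (F ⟨b, hb⟩)) ∧
      (∀ (v : L) (hv : v ∈ D.Np),
        (v ∈ D.sl.even → F ⟨v, hv⟩ ∈ sM.even) ∧ (v ∈ D.sl.odd → F ⟨v, hv⟩ ∈ sM.odd)) ∧
      (∀ i, ∀ (v : L) (hvi : v ∈ D.gp i) (hv : v ∈ D.Np), F ⟨v, hv⟩ = f v) := by
  have hpres0 := D.presented_zero hpres
  obtain ⟨t, ht, ht1⟩ := D.exists_t
  obtain ⟨Φ, hΦ1, hΦ2, hΦ3⟩ := D.exists_hom hpres0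
  have hf : ∀ p, ∀ x ∈ D.V, x ∈ D.sl.par p → f x ∈ sM.par p := by
    have h1 : D.V ≤ sM.odd.comap (f ∘ₗ D.sl.o) := iSup_le fun i x hx =>
      (hfpar i _ (CartanDatum.o_sub (D.gp_graded i) x hx)).2 (D.sl.o_mem x)
    have h0 : D.V ≤ sM.even.comap (f ∘ₗ (LinearMap.id - D.sl.o)) := iSup_le fun i x hx =>
      (hfpar i _ (sub_mem hx (CartanDatum.o_sub (D.gp_graded i) x hx))).1 (D.sl.e_mem x)
    intro p x hx hp
    cases p
    · have := h0 hx
      simp only [Submodule.mem_comap, LinearMap.comp_apply, LinearMap.sub_apply,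
        LinearMap.id_apply, D.sl.o_even hp, sub_zero] at this
      exact this
    · have := h1 hx
      simp only [Submodule.mem_comap, LinearMap.comp_apply, D.sl.o_odd hp] at this
      exact this
  have hinj : ∀ n p m, Wd D sM f n p 0 m → m = 0 := by
    intro n p m h
    obtain ⟨w, hw, hw'⟩ := h.rep Φ hΦ1 hΦ2 hΦ3 hf
    have hw0 : w = 0 := by
      have := congrArg (fun A => A 1) hw
      simpa [lm_apply] using this.symm
    have h2 := congrArg Prod.fst (hw' 0 1)
    have hn := h.pos
    have h3 : (n : ℂ) • m = 0 := by
      rw [hw0, map_zero] at h2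
      simp only [LinearMap.zero_apply, map_zero, zero_add, one_smul, Prod.fst_zero] at h2
      exact h2.symm
    exact (smul_eq_zero.1 h3).resolve_left (Nat.cast_ne_zero.2 hn.ne')
  set G := ⨆ np, Gp D sM f np with hG
  have hGi : ∀ g ∈ G, g.1 = 0 → g.2 = 0 := fun g hg h0 => G_inj t ht ht1 hinj hg h0
  have hdom : G.toLinearPMap.domain = D.Np := G_fst
  let F : D.Np →ₗ[ℂ] M := G.toLinearPMap.toFun ∘ₗ Submodule.inclusion hdom.ge
  have hF : ∀ (v : L) (hv : v ∈ D.Np), (v, F ⟨v, hv⟩) ∈ G := fun v hv =>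
    Submodule.mem_graph_toLinearPMap hGi ⟨v, hdom.ge hv⟩
  have huniq : ∀ (v : L) (hv : v ∈ D.Np) (m : M), (v, m) ∈ G → F ⟨v, hv⟩ = m := by
    intro v hv m hm
    have := hGi _ (sub_mem (hF v hv) hm) (by simp)
    exact sub_eq_zero.1 this
  refine ⟨F, ⟨?_, ?_, ?_⟩, ?_⟩
  · intro a b ha hb hab
    exact huniq _ _ _ (G_br (hF a ha) (hF b hb))
  · intro v hv
    obtain ⟨g0, g1, h0, h1, a0, b0, a1, b1, e⟩ := G_split hf (hF v hv)
    have e1 : v = g0.1 + g1.1 := congrArg Prod.fst e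
    have e2 : F ⟨v, hv⟩ = g0.2 + g1.2 := congrArg Prod.snd e
    constructor
    · intro hve
      have hz : g1.1 = 0 := by
        have : g1.1 ∈ D.sl.even := by
          have : g1.1 = v - g0.1 := by rw [e1]; abel
          rw [this]; exact sub_mem hve a0
        exact (Submodule.disjoint_def.1 D.sl.compl.disjoint) _ this a1
      rw [e2, hGi g1 h1 hz, add_zero]; exact b0
    · intro hvo
      have hz : g0.1 = 0 := by
        have : g0.1 ∈ D.sl.odd := by
          have : g0.1 = v - g1.1 := by rw [e1]; abel
          rw [this]; exact sub_mem hvo a1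
        exact (Submodule.disjoint_def.1 D.sl.compl.disjoint) _ a0 this
      rw [e2, hGi g0 h0 hz, zero_add]; exact b1
  · intro i v hvi hv
    exact huniq _ _ _ (G_gen (Submodule.mem_iSup_of_mem i hvi))
  · rintro F' ⟨k1, -, k3⟩
    have hN : D.Np ≤ (LinearMap.eqLocus F' F).map D.Np.subtype := by
      apply Np_le
      · refine iSup_le fun i v hv => ?_
        have hvN : v ∈ D.Np := V_le_Np (Submodule.mem_iSup_of_mem i hv)
        refine ⟨⟨v, hvN⟩, ?_, rfl⟩
        simp only [SetLike.mem_coe, LinearMap.mem_eqLocus]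
        rw [k3 i v hv hvN, huniq v hvN _ (G_gen (Submodule.mem_iSup_of_mem i hv))]
      · rintro _ ⟨⟨a, ha⟩, ha', rfl⟩ _ ⟨⟨b, hb⟩, hb', rfl⟩
        simp only [SetLike.mem_coe, LinearMap.mem_eqLocus] at ha' hb'
        refine ⟨⟨_, Np_br ha hb⟩, ?_, rfl⟩
        simp only [SetLike.mem_coe, LinearMap.mem_eqLocus]
        rw [k1 a b ha hb, huniq _ _ _ (G_br (hF a ha) (hF b hb)), ha', hb']
    ext ⟨v, hv⟩
    obtain ⟨⟨w, hw⟩, hw', e⟩ := hN hv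
    have e' : w = v := e
    subst e'
    exact hw'
end

section
/- With A a Cartan datum as above, g̃(A) contains a unique maximal ideal r among ideals intersecting h trivially, and r = (r ∩ ñ⁻) ⊕ (r ∩ ñ⁺). -/
namespace GT

variable {L : Type*} [AddCommGroup L] [Module ℂ L]

/-- homogeneous -/
def Hm (sl : SuperLie L) (x : L) : Prop := x ∈ sl.even ∨ x ∈ sl.odd

/-- graded submodule -/
def Gr (sl : SuperLie L) (S : Submodule ℂ L) : Prop := S ≤ (S ⊓ sl.even) ⊔ (S ⊓ sl.odd)

theorem jac (sl : SuperLie L) {x y : L} (hx : Hm sl x) (hy : Hm sl y) :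
    ∃ e : ℂ, ∀ z, sl.bracket x (sl.bracket y z) =
      sl.bracket (sl.bracket x y) z + e • sl.bracket y (sl.bracket x z) := by
  rcases hx with hx | hx
  · exact ⟨1, fun z => by rw [sl.jacobi_e x hx y z, one_smul]⟩
  rcases hy with hy | hy
  · exact ⟨1, fun z => by rw [sl.jacobi_oe x hx y hy z, one_smul]⟩
  · exact ⟨-1, fun z => by rw [sl.jacobi_oo x hx y hy z, neg_smul, one_smul, sub_eq_add_neg]⟩

theorem skew (sl : SuperLie L) {x y : L} (hx : Hm sl x) (hy : Hm sl y) :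
    ∃ e : ℂ, sl.bracket x y = e • sl.bracket y x := by
  rcases hx with hx | hx
  · exact ⟨-1, by rw [sl.skew_e x hx y, neg_smul, one_smul]⟩
  rcases hy with hy | hy
  · exact ⟨-1, by rw [sl.skew_e y hy x, neg_smul, one_smul, neg_neg]⟩
  · exact ⟨1, by rw [sl.symm_oo x hx y hy, one_smul]⟩

theorem Gr.exists {sl : SuperLie L} {S : Submodule ℂ L} (h : Gr sl S) {x : L} (hx : x ∈ S) :
    ∃ a ∈ S, ∃ b ∈ S, a ∈ sl.even ∧ b ∈ sl.odd ∧ a + b = x := by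
  obtain ⟨a, ha, b, hb, rfl⟩ := Submodule.mem_sup.1 (h hx)
  exact ⟨a, ha.1, b, hb.1, ha.2, hb.2, rfl⟩

theorem Gr.le {sl : SuperLie L} {S K : Submodule ℂ L} (h : Gr sl S)
    (H : ∀ x ∈ S, Hm sl x → x ∈ K) : S ≤ K := by
  intro x hx
  obtain ⟨a, ha, b, hb, ha', hb', rfl⟩ := h.exists hx
  exact K.add_mem (H a ha (Or.inl ha')) (H b hb (Or.inr hb'))

theorem Gr.sup {sl : SuperLie L} {S T : Submodule ℂ L} (h : Gr sl S) (h' : Gr sl T) :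
    Gr sl (S ⊔ T) := by
  refine sup_le (h.trans ?_) (h'.trans ?_)
  · exact sup_le_sup (inf_le_inf_right _ le_sup_left) (inf_le_inf_right _ le_sup_left)
  · exact sup_le_sup (inf_le_inf_right _ le_sup_right) (inf_le_inf_right _ le_sup_right)

theorem Gr.iSup {ι : Type*} {sl : SuperLie L} {S : ι → Submodule ℂ L} (h : ∀ i, Gr sl (S i)) :
    Gr sl (⨆ i, S i) := by
  refine iSup_le fun i => (h i).trans ?_
  exact sup_le_sup (inf_le_inf_right _ (le_iSup S i)) (inf_le_inf_right _ (le_iSup S i))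

theorem bil (sl : SuperLie L) {S T K : Submodule ℂ L} (hS : Gr sl S) (hT : Gr sl T)
    (H : ∀ x ∈ S, Hm sl x → ∀ y ∈ T, Hm sl y → sl.bracket x y ∈ K) :
    ∀ x ∈ S, ∀ y ∈ T, sl.bracket x y ∈ K := by
  intro x hx y hy
  obtain ⟨a, ha, b, hb, ha', hb', rfl⟩ := hS.exists hx
  obtain ⟨c, hc, d, hd, hc', hd', rfl⟩ := hT.exists hy
  simp only [map_add, LinearMap.add_apply]
  exact K.add_mem (K.add_mem (H _ ha (.inl ha') _ hc (.inl hc')) (H _ hb (.inr hb') _ hc (.inl hc')))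
    (K.add_mem (H _ ha (.inl ha') _ hd (.inr hd')) (H _ hb (.inr hb') _ hd (.inr hd')))

theorem flp (sl : SuperLie L) {S T K : Submodule ℂ L} (hS : Gr sl S) (hT : Gr sl T)
    (H : ∀ x ∈ S, ∀ y ∈ T, sl.bracket x y ∈ K) :
    ∀ y ∈ T, ∀ x ∈ S, sl.bracket y x ∈ K := by
  apply bil sl hT hS
  intro y hy hy' x hx hx'
  obtain ⟨e, he⟩ := skew sl hy' hx'
  rw [he]
  exact K.smul_mem _ (H x hx y hy)

theorem le_lieSpan (b : L →ₗ[ℂ] L →ₗ[ℂ] L) (P : Submodule ℂ L) : P ≤ lieSpan b P :=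
  le_sInf fun _ h => h.1

theorem lieSpan_closed (b : L →ₗ[ℂ] L →ₗ[ℂ] L) (P : Submodule ℂ L) :
    ∀ x ∈ lieSpan b P, ∀ y ∈ lieSpan b P, b x y ∈ lieSpan b P := by
  intro x hx y hy
  simp only [lieSpan, Submodule.mem_sInf] at *
  exact fun N hN => hN.2 x (hx N hN) y (hy N hN)

theorem lieSpan_ind' (sl : SuperLie L) {P K : Submodule ℂ L} (hP : Gr sl P) (hPK : P ≤ K)
    (H : ∀ x ∈ K, Hm sl x → ∀ y ∈ K, Hm sl y → sl.bracket x y ∈ K) :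
    lieSpan sl.bracket P ≤ (K ⊓ sl.even) ⊔ (K ⊓ sl.odd) := by
  refine sInf_le ⟨hP.trans (sup_le_sup (inf_le_inf_right _ hPK) (inf_le_inf_right _ hPK)), ?_⟩
  have hle : (K ⊓ sl.even) ⊔ (K ⊓ sl.odd) ≤ K := sup_le inf_le_left inf_le_left
  have hg : Gr sl ((K ⊓ sl.even) ⊔ (K ⊓ sl.odd)) := by
    refine sup_le_sup ?_ ?_
    · exact le_inf le_sup_left inf_le_right
    · exact le_inf le_sup_right inf_le_right
  apply bil sl hg hg
  intro x hx hx' y hy hy'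
  have h := H x (hle hx) hx' y (hle hy) hy'
  rcases hx' with hx' | hx' <;> rcases hy' with hy' | hy'
  · exact Submodule.mem_sup_left ⟨h, sl.ee_mem _ hx' _ hy'⟩
  · exact Submodule.mem_sup_right ⟨h, sl.eo_mem _ hx' _ hy'⟩
  · exact Submodule.mem_sup_right ⟨h, sl.oe_mem _ hx' _ hy'⟩
  · exact Submodule.mem_sup_left ⟨h, sl.oo_mem _ hx' _ hy'⟩

theorem lieSpan_ind (sl : SuperLie L) {P K : Submodule ℂ L} (hP : Gr sl P) (hPK : P ≤ K)
    (H : ∀ x ∈ K, Hm sl x → ∀ y ∈ K, Hm sl y → sl.bracket x y ∈ K) :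
    lieSpan sl.bracket P ≤ K :=
  (lieSpan_ind' sl hP hPK H).trans (sup_le inf_le_left inf_le_left)

theorem lieSpan_gr (sl : SuperLie L) {P : Submodule ℂ L} (hP : Gr sl P) :
    Gr sl (lieSpan sl.bracket P) :=
  lieSpan_ind' sl hP (le_lieSpan _ _) fun x hx _ y hy _ => lieSpan_closed _ _ x hx y hy

/-- elements sent to `K` by all homogeneous elements of `S` -/
def stab (sl : SuperLie L) (S K : Submodule ℂ L) : Submodule ℂ L where
  carrier := {y | ∀ x ∈ S, Hm sl x → sl.bracket x y ∈ K}
  zero_mem' := by intro x _ _; simp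
  add_mem' := by
    intro a b ha hb x hx hx'
    rw [map_add]; exact K.add_mem (ha x hx hx') (hb x hx hx')
  smul_mem' := by
    intro c a ha x hx hx'
    rw [map_smul]; exact K.smul_mem _ (ha x hx hx')

theorem h_stab (sl : SuperLie L) {h P : Submodule ℂ L} (hh : Gr sl h) (hP : Gr sl P)
    (H : ∀ t ∈ h, ∀ x ∈ P, sl.bracket t x ∈ P) :
    ∀ t ∈ h, ∀ x ∈ lieSpan sl.bracket P, sl.bracket t x ∈ lieSpan sl.bracket P := by
  have key : lieSpan sl.bracket P ≤ lieSpan sl.bracket P ⊓ stab sl h (lieSpan sl.bracket P) := by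
    apply lieSpan_ind sl hP
    · exact le_inf (le_lieSpan _ _) fun x hx t ht _ => le_lieSpan _ _ (H t ht x hx)
    · intro x hx hx' y hy hy'
      refine ⟨lieSpan_closed _ _ _ hx.1 _ hy.1, fun t ht ht' => ?_⟩
      obtain ⟨e, he⟩ := jac sl ht' hx'
      rw [he]
      exact Submodule.add_mem _ (lieSpan_closed _ _ _ (hx.2 t ht ht') _ hy.1)
        (Submodule.smul_mem _ _ (lieSpan_closed _ _ _ hx.1 _ (hy.2 t ht ht')))
  exact bil sl hh (lieSpan_gr sl hP) fun t ht ht' x hx _ => (key hx).2 t ht ht'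

theorem q_stab (sl : SuperLie L) {h P Q : Submodule ℂ L} (hh : Gr sl h) (hP : Gr sl P)
    (hQ : Gr sl Q) (H : ∀ t ∈ h, ∀ x ∈ P, sl.bracket t x ∈ P)
    (HQ : ∀ t ∈ Q, ∀ x ∈ P, sl.bracket t x ∈ h) :
    ∀ t ∈ Q, ∀ x ∈ lieSpan sl.bracket P, sl.bracket t x ∈ h ⊔ lieSpan sl.bracket P := by
  have hN := lieSpan_gr sl hP
  have h1 := h_stab sl hh hP H
  have h2 : ∀ a ∈ h ⊔ lieSpan sl.bracket P, ∀ x ∈ lieSpan sl.bracket P,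
      sl.bracket a x ∈ lieSpan sl.bracket P := by
    intro a ha x hx
    obtain ⟨t, ht, b, hb, rfl⟩ := Submodule.mem_sup.1 ha
    rw [map_add, LinearMap.add_apply]
    exact Submodule.add_mem _ (h1 t ht x hx) (lieSpan_closed _ _ _ hb _ hx)
  have h3 := flp sl (hh.sup hN) hN h2
  have key : lieSpan sl.bracket P ≤
      lieSpan sl.bracket P ⊓ stab sl Q (h ⊔ lieSpan sl.bracket P) := by
    apply lieSpan_ind sl hP
    · exact le_inf (le_lieSpan _ _) fun x hx t ht _ => Submodule.mem_sup_left (HQ t ht x hx)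
    · intro x hx hx' y hy hy'
      refine ⟨lieSpan_closed _ _ _ hx.1 _ hy.1, fun t ht ht' => ?_⟩
      obtain ⟨e, he⟩ := jac sl ht' hx'
      rw [he]
      exact Submodule.mem_sup_right (Submodule.add_mem _ (h2 _ (hx.2 t ht ht') _ hy.1)
        (Submodule.smul_mem _ _ (h3 _ hx.1 _ (hy.2 t ht ht'))))
  exact bil sl hQ hN fun t ht ht' x hx _ => (key hx).2 t ht ht'

/-- elements of `T` whose left multiplication preserves `T` -/
def lstab (sl : SuperLie L) (T : Submodule ℂ L) : Submodule ℂ L where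
  carrier := {y | y ∈ T ∧ ∀ x ∈ T, sl.bracket y x ∈ T}
  zero_mem' := ⟨T.zero_mem, by intro x _; simp⟩
  add_mem' := by
    intro a b ha hb
    refine ⟨T.add_mem ha.1 hb.1, fun x hx => ?_⟩
    rw [map_add]; exact T.add_mem (ha.2 x hx) (hb.2 x hx)
  smul_mem' := by
    intro c a ha
    refine ⟨T.smul_mem _ ha.1, fun x hx => ?_⟩
    rw [map_smul]; exact T.smul_mem _ (ha.2 x hx)

theorem lstab_ind (sl : SuperLie L) {P T : Submodule ℂ L} (hP : Gr sl P) (h : P ≤ lstab sl T) :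
    lieSpan sl.bracket P ≤ T := by
  have : lieSpan sl.bracket P ≤ lstab sl T := by
    apply lieSpan_ind sl hP h
    intro x hx hx' y hy hy'
    refine ⟨hx.2 _ hy.1, fun z hz => ?_⟩
    obtain ⟨e, he⟩ := jac sl hx' hy'
    have := eq_sub_of_add_eq (he z).symm
    rw [this]
    exact T.sub_mem (hx.2 _ (hy.2 _ hz)) (T.smul_mem _ (hy.2 _ (hx.2 _ hz)))
  exact fun x hx => (this hx).1

theorem tri (sl : SuperLie L) {h P Q : Submodule ℂ L} (hh : Gr sl h) (hP : Gr sl P)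
    (hQ : Gr sl Q) (hhh : ∀ t ∈ h, ∀ x ∈ h, sl.bracket t x ∈ h)
    (HP : ∀ t ∈ h, ∀ x ∈ P, sl.bracket t x ∈ P)
    (HQ : ∀ t ∈ h, ∀ x ∈ Q, sl.bracket t x ∈ Q)
    (HPQ : ∀ t ∈ P, ∀ x ∈ Q, sl.bracket t x ∈ h) :
    lieSpan sl.bracket (h ⊔ (P ⊔ Q)) ≤
      lieSpan sl.bracket Q ⊔ (h ⊔ lieSpan sl.bracket P) := by
  have lP : lieSpan sl.bracket P ≤ lieSpan sl.bracket Q ⊔ (h ⊔ lieSpan sl.bracket P) :=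
    le_sup_right.trans le_sup_right
  have lh : h ≤ lieSpan sl.bracket Q ⊔ (h ⊔ lieSpan sl.bracket P) :=
    le_sup_left.trans le_sup_right
  have lQ : lieSpan sl.bracket Q ≤ lieSpan sl.bracket Q ⊔ (h ⊔ lieSpan sl.bracket P) :=
    le_sup_left
  have a1 := h_stab sl hh hP HP
  have a2 := h_stab sl hh hQ HQ
  have b1 := q_stab sl hh hP hQ HP (flp sl hP hQ HPQ)
  have b2 := q_stab sl hh hQ hP HQ HPQ
  have c1 := flp sl hh hP HP
  have c2 := flp sl hh hQ HQ
  apply lstab_ind sl (hh.sup (hP.sup hQ))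
  refine sup_le ?_ (sup_le ?_ ?_)
  · intro x hx
    refine ⟨lh hx, fun y hy => ?_⟩
    obtain ⟨q, hq, w, hw, rfl⟩ := Submodule.mem_sup.1 hy
    obtain ⟨t, ht, p, hp, rfl⟩ := Submodule.mem_sup.1 hw
    simp only [map_add]
    exact add_mem (lQ (a2 x hx q hq)) (add_mem (lh (hhh x hx t ht)) (lP (a1 x hx p hp)))
  · intro x hx
    refine ⟨lP (le_lieSpan _ _ hx), fun y hy => ?_⟩
    obtain ⟨q, hq, w, hw, rfl⟩ := Submodule.mem_sup.1 hy
    obtain ⟨t, ht, p, hp, rfl⟩ := Submodule.mem_sup.1 hw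
    simp only [map_add]
    exact add_mem (sup_le lh lQ (b2 x hx q hq)) (add_mem (lP (le_lieSpan _ _ (c1 x hx t ht)))
      (lP (lieSpan_closed _ _ _ (le_lieSpan _ _ hx) _ hp)))
  · intro x hx
    refine ⟨lQ (le_lieSpan _ _ hx), fun y hy => ?_⟩
    obtain ⟨q, hq, w, hw, rfl⟩ := Submodule.mem_sup.1 hy
    obtain ⟨t, ht, p, hp, rfl⟩ := Submodule.mem_sup.1 hw
    simp only [map_add]
    exact add_mem (lQ (lieSpan_closed _ _ _ (le_lieSpan _ _ hx) _ hq))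
      (add_mem (lQ (le_lieSpan _ _ (c2 x hx t ht))) (sup_le lh lP (b1 x hx p hp)))

theorem pull {M : Type*} [AddCommGroup M] [Module ℂ M] (sl : SuperLie L) (j : M →ₗ[ℂ] L)
    (hj : Function.Injective j) (hc : ∀ x y, ∃ z, j z = sl.bracket (j x) (j y))
    (hg : ∀ x, ∃ a b, j a ∈ sl.even ∧ j b ∈ sl.odd ∧ a + b = x) :
    ∃ sM : SuperLie M, (∀ x y, j (sM.bracket x y) = sl.bracket (j x) (j y)) ∧
      (∀ x, x ∈ sM.even ↔ j x ∈ sl.even) ∧ (∀ x, x ∈ sM.odd ↔ j x ∈ sl.odd) := by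
  choose B hB using hc
  let b : M →ₗ[ℂ] M →ₗ[ℂ] M := LinearMap.mk₂ ℂ B
    (fun x y z => hj (by simp [hB])) (fun c x z => hj (by simp [hB]))
    (fun x y z => hj (by simp [hB])) (fun c x z => hj (by simp [hB]))
  have hb : ∀ x y, j (b x y) = sl.bracket (j x) (j y) := fun x y => hB x y
  refine ⟨{ even := sl.even.comap j, odd := sl.odd.comap j, bracket := b, compl := ?_,
            ee_mem := ?_, eo_mem := ?_, oe_mem := ?_, oo_mem := ?_, skew_e := ?_, symm_oo := ?_,
            jacobi_e := ?_, jacobi_oe := ?_, jacobi_oo := ?_ }, hb, fun _ => Iff.rfl,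
            fun _ => Iff.rfl⟩
  · constructor
    · rw [Submodule.disjoint_def]
      intro x hx hx'
      apply hj
      rw [map_zero]
      exact Submodule.disjoint_def.1 sl.compl.disjoint _ hx hx'
    · rw [codisjoint_iff, eq_top_iff]
      intro x _
      obtain ⟨a, c, ha, hc, rfl⟩ := hg x
      exact Submodule.add_mem_sup ha hc
  · intro x hx y hy; simp only [Submodule.mem_comap, hb] at *; exact sl.ee_mem _ hx _ hy
  · intro x hx y hy; simp only [Submodule.mem_comap, hb] at *; exact sl.eo_mem _ hx _ hy
  · intro x hx y hy; simp only [Submodule.mem_comap, hb] at *; exact sl.oe_mem _ hx _ hy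
  · intro x hx y hy; simp only [Submodule.mem_comap, hb] at *; exact sl.oo_mem _ hx _ hy
  · intro x hx y; apply hj; simp only [map_neg, hb]; exact sl.skew_e _ hx _
  · intro x hx y hy; apply hj; simp only [hb]; exact sl.symm_oo _ hx _ hy
  · intro x hx y z; apply hj; simp only [map_add, hb]; exact sl.jacobi_e _ hx _ _
  · intro x hx y hy z; apply hj; simp only [map_add, hb]; exact sl.jacobi_oe _ hx _ hy _
  · intro x hx y hy z; apply hj; simp only [map_sub, hb]; exact sl.jacobi_oo _ hx _ hy _

theorem gr_h (D : CartanDatum L) : Gr D.sl D.h :=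
  Gr.sup ((le_inf le_rfl D.hE_le).trans le_sup_left) ((le_inf le_rfl D.hO_le).trans le_sup_right)

theorem gr_gp (D : CartanDatum L) : Gr D.sl (⨆ i, D.gp i) := Gr.iSup fun i => (D.gp_graded i).le

theorem gr_gm (D : CartanDatum L) : Gr D.sl (⨆ i, D.gm i) := Gr.iSup fun i => (D.gm_graded i).le

theorem gr_C (D : CartanDatum L) : Gr D.sl D.genC := (gr_h D).sup ((gr_gp D).sup (gr_gm D))

theorem hE_le_h (D : CartanDatum L) : D.hE ≤ D.h := le_sup_left

theorem hh_mem (D : CartanDatum L) : ∀ t ∈ D.h, ∀ x ∈ D.h, D.sl.bracket t x ∈ D.h := by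
  intro t ht x hx
  obtain ⟨a, ha, b, hb, rfl⟩ := Submodule.mem_sup.1 ht
  obtain ⟨c, hc, d, hd, rfl⟩ := Submodule.mem_sup.1 hx
  have e1 : D.sl.bracket a (c + d) = 0 := D.quasitoral a ha _ hx
  have e2 : D.sl.bracket b c = 0 := by
    have := D.sl.skew_e c (D.hE_le hc) b
    rw [D.quasitoral c hc b (Submodule.mem_sup_right hb)] at this
    exact (neg_eq_zero.1 this.symm)
  rw [map_add D.sl.bracket, LinearMap.add_apply, e1, map_add, e2, zero_add, zero_add]
  exact hE_le_h D (D.brOO b hb d hd)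

theorem iSup_bil {ι : Type*} (f : L →ₗ[ℂ] L) (S : ι → Submodule ℂ L) (K : Submodule ℂ L)
    (H : ∀ i, ∀ x ∈ S i, f x ∈ K) : ∀ x ∈ ⨆ i, S i, f x ∈ K := by
  have : ⨆ i, S i ≤ K.comap f := iSup_le fun i x hx => H i x hx
  exact fun x hx => this hx

theorem tri_le (D : CartanDatum L) :
    lieSpan D.sl.bracket D.genC ≤ D.Nm ⊔ (D.h ⊔ D.Np) := by
  refine tri D.sl (gr_h D) (gr_gp D) (gr_gm D) (hh_mem D) ?_ ?_ ?_
  · intro t ht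
    exact iSup_bil _ _ _ fun i x hx => Submodule.mem_iSup_of_mem i (D.gp_mod i t ht x hx)
  · intro t ht
    exact iSup_bil _ _ _ fun i x hx => Submodule.mem_iSup_of_mem i (D.gm_mod i t ht x hx)
  · intro x hx y hy
    refine iSup_bil (D.sl.bracket.flip y) _ D.h (fun i x hx => ?_) x hx
    refine iSup_bil (D.sl.bracket x) _ D.h (fun j y hy => ?_) y hy
    by_cases hij : i = j
    · subst hij
      exact D.pair_mem i x hx y hy
    · rw [D.pair_ne i j hij x hx y hy]; exact D.h.zero_mem

theorem h_le_C (D : CartanDatum L) : D.h ≤ D.genC := le_sup_left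
theorem gp_le_C (D : CartanDatum L) (i) : D.gp i ≤ D.genC :=
  (le_iSup D.gp i).trans (le_sup_left.trans le_sup_right)
theorem gm_le_C (D : CartanDatum L) (i) : D.gm i ≤ D.genC :=
  (le_iSup D.gm i).trans (le_sup_right.trans le_sup_right)

universe u

theorem gen {L : Type} [AddCommGroup L] [Module ℂ L] (D : CartanDatum L)
    (hpres : CartanDatum.Presented.{0, u} D) : lieSpan D.sl.bracket D.genC = ⊤ := by
  set S := lieSpan D.sl.bracket D.genC with hS
  have hSg : Gr D.sl S := lieSpan_gr D.sl (gr_C D)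
  have hCS : D.genC ≤ S := le_lieSpan _ _
  have hSc := lieSpan_closed D.sl.bracket D.genC
  let u : L ≃ₗ[ℂ] ULift.{u} L := ULift.moduleEquiv.symm
  let v : S ≃ₗ[ℂ] ULift.{u} S := ULift.moduleEquiv.symm
  let j : ULift.{u} S →ₗ[ℂ] L := S.subtype ∘ₗ v.symm.toLinearMap
  have hj : Function.Injective j := S.injective_subtype.comp v.symm.injective
  have hjS : ∀ x, j x ∈ S := fun x => (v.symm x).2
  have hjv : ∀ x, ∀ hx : x ∈ S, j (v ⟨x, hx⟩) = x := fun x hx => rfl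
  obtain ⟨sM, m1, m2, m3⟩ := pull D.sl j hj
    (fun x y => ⟨v ⟨_, hSc _ (hjS x) _ (hjS y)⟩, hjv _ _⟩)
    (fun x => by
      obtain ⟨a, ha, b, hb, ha', hb', e⟩ := hSg.exists (hjS x)
      refine ⟨v ⟨a, ha⟩, v ⟨b, hb⟩, ha', hb', hj ?_⟩
      rw [map_add, hjv, hjv, e])
  obtain ⟨sU, u1, u2, u3⟩ := pull D.sl u.symm.toLinearMap u.symm.injective
    (fun x y => ⟨u (D.sl.bracket (u.symm x) (u.symm y)), by simp⟩)
    (fun x => by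
      have : u.symm x ∈ D.sl.even ⊔ D.sl.odd := by
        rw [D.sl.compl.sup_eq_top]; trivial
      obtain ⟨a, ha, b, hb, e⟩ := Submodule.mem_sup.1 this
      refine ⟨u a, u b, by simpa using ha, by simpa using hb, ?_⟩
      rw [← map_add, e]; simp)
  simp only [LinearEquiv.coe_coe] at u1 u2 u3
  have uu : ∀ x y, u (D.sl.bracket x y) = sU.bracket (u x) (u y) := by
    intro x y; apply u.symm.injective; rw [u1]; simp
  obtain ⟨pr, hpr⟩ := S.subtype.exists_leftInverse_of_injective (by simp)
  have hpr' : ∀ x ∈ S, j (v (pr x)) = x := by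
    intro x hx
    have := LinearMap.congr_fun hpr ⟨x, hx⟩
    simp only [LinearMap.comp_apply, Submodule.subtype_apply, LinearMap.id_apply] at this
    rw [this]
    rfl
  have hbr : ∀ x ∈ D.genC, ∀ y ∈ D.genC,
      (v.toLinearMap ∘ₗ pr) (D.sl.bracket x y)
        = sM.bracket ((v.toLinearMap ∘ₗ pr) x) ((v.toLinearMap ∘ₗ pr) y) := by
    intro x hx y hy
    apply hj
    rw [m1]
    simp only [LinearMap.comp_apply, LinearEquiv.coe_coe]
    rw [hpr' x (hCS hx), hpr' y (hCS hy), hpr' _ (hSc _ (hCS hx) _ (hCS hy))]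
  obtain ⟨F, ⟨F1, F2, F3, F4⟩, -⟩ := hpres (ULift.{u} S) sM (v.toLinearMap ∘ₗ pr)
    (fun a ha b hb => hbr _ (h_le_C D ha) _ (h_le_C D hb))
    (fun i a ha b hb => hbr _ (h_le_C D ha) _ (gp_le_C D i hb))
    (fun i a ha b hb => hbr _ (h_le_C D ha) _ (gm_le_C D i hb))
    (fun i a ha b hb => hbr _ (gp_le_C D i ha) _ (gm_le_C D i hb))
    (fun i k hik a ha b hb => by
      rw [← hbr _ (gp_le_C D i ha) _ (gm_le_C D k hb), D.pair_ne i k hik a ha b hb, map_zero])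
    (fun x hx hx' => by
      rw [m2]; simp only [LinearMap.comp_apply, LinearEquiv.coe_coe]; rwa [hpr' x (hCS hx)])
    (fun x hx hx' => by
      rw [m3]; simp only [LinearMap.comp_apply, LinearEquiv.coe_coe]; rwa [hpr' x (hCS hx)])
  have huniq := hpres (ULift.{u} L) sU u.toLinearMap
    (fun a _ b _ => uu a b) (fun i a _ b _ => uu a b) (fun i a _ b _ => uu a b)
    (fun i a _ b _ => uu a b)
    (fun i k hik a ha b hb => by
      simp only [LinearEquiv.coe_coe]
      rw [← uu, D.pair_ne i k hik a ha b hb, map_zero])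
    (fun x _ hx' => by rw [u2]; simpa using hx')
    (fun x _ hx' => by rw [u3]; simpa using hx')
  have e := huniq.unique (y₁ := u.toLinearMap) (y₂ := u.toLinearMap ∘ₗ j ∘ₗ F)
    ⟨uu, fun x hx' => by rw [u2]; simpa using hx', fun x hx' => by rw [u3]; simpa using hx',
      fun _ _ => rfl⟩
    ⟨fun a b => by
        simp only [LinearMap.comp_apply, LinearEquiv.coe_coe]
        rw [F1, m1, uu],
      fun x hx' => by rw [u2]; simpa using (m2 _).1 (F2 x hx'),
      fun x hx' => by rw [u3]; simpa using (m3 _).1 (F3 x hx'),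
      fun x hx => by
        simp only [LinearMap.comp_apply, LinearEquiv.coe_coe]
        rw [F4 x hx]
        simp only [LinearMap.comp_apply, LinearEquiv.coe_coe]
        rw [hpr' x (hCS hx)]⟩
  rw [eq_top_iff]
  intro x _
  have := LinearMap.congr_fun e x
  simp only [LinearMap.comp_apply, LinearEquiv.coe_coe] at this
  rw [u.injective this]
  exact hjS _

theorem exists_t (D : CartanDatum L) : ∃ t ∈ D.hE, ∀ i, D.alpha i t = 1 := by
  let g : D.hE →ₗ[ℂ] (Fin D.n → ℂ) := LinearMap.pi fun i => (D.alpha i).domRestrict D.hE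
  have h1 : LinearIndependent ℂ (fun i (x : D.hE) => D.alpha i x) := by
    have := D.indep.map' (LinearMap.ltoFun ℂ D.hE ℂ ℂ)
      (LinearMap.ker_eq_bot.2 DFunLike.coe_injective)
    exact this
  have h2 := span_flip_eq_top_iff_linearIndependent.2 h1
  have h3 : (⊤ : Submodule ℂ (Fin D.n → ℂ)) ≤ LinearMap.range g := by
    rw [← h2, Submodule.span_le]
    rintro _ ⟨x, rfl⟩
    exact ⟨x, rfl⟩
  obtain ⟨x, hx⟩ := h3 (x := fun _ => 1) trivial
  exact ⟨x, x.2, fun i => congrFun hx i⟩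

theorem inv_comp (f : Module.End ℂ L) (p : Submodule ℂ L) (hp : ∀ x ∈ p, f x ∈ p)
    (s : Finset ℂ) : ∀ v : ℂ → L, (∀ μ ∈ s, v μ ∈ f.eigenspace μ) → ∑ μ ∈ s, v μ ∈ p →
      ∀ μ ∈ s, v μ ∈ p := by
  induction s using Finset.induction_on with
  | empty => intro v _ _ μ hμ; simp at hμ
  | insert a s ha ih =>
    intro v hv hs
    have hE : ∀ μ ∈ insert a s, f (v μ) = μ • v μ :=
      fun μ hμ => Module.End.mem_eigenspace_iff.1 (hv μ hμ)
    have h1 : ∑ μ ∈ s, (μ - a) • v μ ∈ p := by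
      have := p.sub_mem (hp _ hs) (p.smul_mem a hs)
      rw [map_sum, Finset.smul_sum, ← Finset.sum_sub_distrib, Finset.sum_insert ha] at this
      rw [hE a (Finset.mem_insert_self _ _), sub_self, zero_add] at this
      convert this using 1
      refine Finset.sum_congr rfl fun μ hμ => ?_
      rw [hE μ (Finset.mem_insert_of_mem hμ), sub_smul]
    have h2 := ih (fun μ => (μ - a) • v μ)
      (fun μ hμ => Submodule.smul_mem _ _ (hv μ (Finset.mem_insert_of_mem hμ))) h1
    have h3 : ∀ μ ∈ s, v μ ∈ p := by
      intro μ hμ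
      have hne : μ - a ≠ 0 := sub_ne_zero.2 (fun h => ha (h ▸ hμ))
      exact (p.smul_mem_iff hne).1 (h2 μ hμ)
    intro μ hμ
    rcases Finset.mem_insert.1 hμ with rfl | hμ
    · rw [Finset.sum_insert ha] at hs
      exact (p.add_mem_iff_left (p.sum_mem h3)).1 hs
    · exact h3 μ hμ

theorem inv_le (f : Module.End ℂ L) (p : Submodule ℂ L) (hp : ∀ x ∈ p, f x ∈ p)
    (hf : ⨆ μ, f.eigenspace μ = ⊤) : p ≤ ⨆ μ, p ⊓ f.eigenspace μ := by
  classical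
  intro x hx
  have hx' : x ∈ ⨆ μ, f.eigenspace μ := by rw [hf]; trivial
  obtain ⟨m, hm, rfl⟩ := (Submodule.mem_iSup_iff_exists_finsupp _ _).1 hx'
  have := inv_comp f p hp m.support m (fun μ _ => hm μ) hx
  exact Submodule.sum_mem _ fun μ hμ => Submodule.mem_iSup_of_mem μ ⟨this μ hμ, hm μ⟩

/-- sum of eigenspaces with eigenvalue in `s` -/
def ES (f : Module.End ℂ L) (s : Set ℂ) : Submodule ℂ L := ⨆ μ ∈ s, f.eigenspace μ

theorem le_ES (f : Module.End ℂ L) {s : Set ℂ} {μ : ℂ} (h : μ ∈ s) : f.eigenspace μ ≤ ES f s :=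
  le_biSup f.eigenspace h

theorem ES_mono (f : Module.End ℂ L) {s t : Set ℂ} (h : s ⊆ t) : ES f s ≤ ES f t :=
  biSup_mono h

theorem ES_disj (f : Module.End ℂ L) {s t : Set ℂ} (h : Disjoint s t) :
    Disjoint (ES f s) (ES f t) :=
  f.eigenspaces_iSupIndep.disjoint_biSup_biSup h

theorem ES_br (sl : SuperLie L) {t : L} (ht : t ∈ sl.even) {s : Set ℂ}
    (hs : ∀ a ∈ s, ∀ b ∈ s, a + b ∈ s) :
    ∀ x ∈ ES (sl.bracket t) s, ∀ y ∈ ES (sl.bracket t) s,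
      sl.bracket x y ∈ ES (sl.bracket t) s := by
  intro x hx y hy
  have hx2 : ES (sl.bracket t) s ≤ (ES (sl.bracket t) s).comap (sl.bracket.flip y) := by
    refine iSup₂_le fun a ha x hx => ?_
    have hy2 : ES (sl.bracket t) s ≤ (ES (sl.bracket t) s).comap (sl.bracket x) := by
      refine iSup₂_le fun b hb y hy => ?_
      refine le_ES _ (hs a ha b hb) ?_
      rw [Module.End.mem_eigenspace_iff] at *
      rw [sl.jacobi_e t ht, hx, hy, map_smul, map_smul, LinearMap.smul_apply, add_smul]
    exact hy2 hy
  exact hx2 hx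

theorem main {L : Type*} [AddCommGroup L] [Module ℂ L] (D : CartanDatum L)
    (hT : D.Nm ⊔ (D.h ⊔ D.Np) = ⊤) :
    ∃! r : Submodule ℂ L,
      IsBracketIdeal D.sl.bracket r ∧ r ⊓ D.h = ⊥ ∧
      (∀ I : Submodule ℂ L, IsBracketIdeal D.sl.bracket I → I ⊓ D.h = ⊥ → I ≤ r) ∧
      r = (r ⊓ D.Nm) ⊔ (r ⊓ D.Np) := by
  obtain ⟨t, ht, hα⟩ := exists_t D
  let f : Module.End ℂ L := D.sl.bracket t
  have te := D.hE_le ht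
  have i0p : {μ : ℂ | μ.re = 0} ⊆ {μ : ℂ | 0 ≤ μ.re} := by
    intro μ h; simp only [Set.mem_ofPred_eq] at h ⊢; exact h.ge
  have ipp : {μ : ℂ | 0 < μ.re} ⊆ {μ : ℂ | 0 ≤ μ.re} := by
    intro μ h; simp only [Set.mem_ofPred_eq] at h ⊢; exact h.le
  have inn : {μ : ℂ | μ.re < 0} ⊆ {μ : ℂ | μ.re ≠ 0} := by
    intro μ h; simp only [Set.mem_ofPred_eq] at h ⊢; exact h.ne
  have ipn : {μ : ℂ | 0 < μ.re} ⊆ {μ : ℂ | μ.re ≠ 0} := by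
    intro μ h; simp only [Set.mem_ofPred_eq] at h ⊢; exact h.ne'
  have inl : {μ : ℂ | μ.re < 0} ⊆ {μ : ℂ | μ.re ≤ 0} := by
    intro μ h; simp only [Set.mem_ofPred_eq] at h ⊢; exact h.le
  have i0l : {μ : ℂ | μ.re = 0} ⊆ {μ : ℂ | μ.re ≤ 0} := by
    intro μ h; simp only [Set.mem_ofPred_eq] at h ⊢; exact h.le
  have lp : D.Np ≤ ES f {μ | 0 < μ.re} := by
    refine sInf_le ⟨iSup_le fun i x hx => le_ES f (μ := 1) (by simp) ?_, ES_br D.sl te ?_⟩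
    · rw [Module.End.mem_eigenspace_iff, ← hα i]
      exact D.gp_wt i t ht x hx
    · intro a ha b hb
      simp only [Set.mem_ofPred_eq, Complex.add_re] at *; linarith
  have lm : D.Nm ≤ ES f {μ | μ.re < 0} := by
    refine sInf_le ⟨iSup_le fun i x hx => le_ES f (μ := -1) (by simp) ?_, ES_br D.sl te ?_⟩
    · rw [Module.End.mem_eigenspace_iff, ← hα i]
      exact D.gm_wt i t ht x hx
    · intro a ha b hb
      simp only [Set.mem_ofPred_eq, Complex.add_re] at *; linarith
  have lh : D.h ≤ ES f {μ | μ.re = 0} := by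
    intro x hx
    refine le_ES f (μ := 0) (by simp) ?_
    rw [Module.End.mem_eigenspace_iff, zero_smul]
    exact D.quasitoral t ht x hx
  have ftop : ⨆ μ, f.eigenspace μ = ⊤ := by
    rw [eq_top_iff, ← hT]
    have : ∀ s, ES f s ≤ ⨆ μ, f.eigenspace μ := fun s => iSup₂_le fun μ _ => le_iSup _ μ
    exact sup_le (lm.trans (this _)) (sup_le (lh.trans (this _)) (lp.trans (this _)))
  have disj : Disjoint (D.Nm ⊔ D.Np) D.h := by
    refine (ES_disj f (s := {μ | μ.re ≠ 0}) (t := {μ | μ.re = 0}) ?_).mono ?_ lh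
    · rw [Set.disjoint_left]; intro μ h1 h2; exact h1 h2
    · exact sup_le (lm.trans (ES_mono f inn))
        (lp.trans (ES_mono f ipn))
  have key : ∀ I : Submodule ℂ L, IsBracketIdeal D.sl.bracket I → I ⊓ D.h = ⊥ →
      I ≤ (I ⊓ D.Nm) ⊔ (I ⊓ D.Np) := by
    intro I hI hIh
    refine (inv_le f I (fun x hx => (hI t x hx).1) ftop).trans (iSup_le fun μ w hw => ?_)
    obtain ⟨hwI, hwμ⟩ := hw
    have hwT : w ∈ D.Nm ⊔ (D.h ⊔ D.Np) := by rw [hT]; trivial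
    obtain ⟨a, ha, w', hw', e⟩ := Submodule.mem_sup.1 hwT
    obtain ⟨b, hb, c, hc, rfl⟩ := Submodule.mem_sup.1 hw'
    rcases lt_trichotomy μ.re 0 with hμ | hμ | hμ
    · have d := ES_disj f (s := {μ | μ.re < 0}) (t := {μ | 0 ≤ μ.re})
        (by rw [Set.disjoint_left]; intro μ h1 h2; simp only [Set.mem_ofPred_eq] at h1 h2; linarith)
      have : w - a = 0 := by
        refine Submodule.disjoint_def.1 d _ (sub_mem (le_ES f hμ hwμ) (lm ha)) ?_
        rw [← e, add_sub_cancel_left]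
        exact add_mem (ES_mono f i0p (lh hb))
          (ES_mono f ipp (lp hc))
      exact Submodule.mem_sup_left ⟨hwI, by rwa [sub_eq_zero.1 this]⟩
    · have d := ES_disj f (s := {μ | μ.re = 0}) (t := {μ | μ.re ≠ 0})
        (by rw [Set.disjoint_left]; intro μ h1 h2; exact h2 h1)
      have : w - b = 0 := by
        refine Submodule.disjoint_def.1 d _ (sub_mem (le_ES f hμ hwμ) (lh hb)) ?_
        rw [← e, show a + (b + c) - b = a + c by abel]
        exact add_mem (ES_mono f inn (lm ha))
          (ES_mono f ipn (lp hc))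
      have h0 : w ∈ I ⊓ D.h := ⟨hwI, by rwa [sub_eq_zero.1 this]⟩
      rw [hIh, Submodule.mem_bot] at h0
      rw [h0]; exact Submodule.zero_mem _
    · have d := ES_disj f (s := {μ | 0 < μ.re}) (t := {μ | μ.re ≤ 0})
        (by rw [Set.disjoint_left]; intro μ h1 h2; simp only [Set.mem_ofPred_eq] at h1 h2; linarith)
      have : w - c = 0 := by
        refine Submodule.disjoint_def.1 d _ (sub_mem (le_ES f hμ hwμ) (lp hc)) ?_
        rw [← e, show a + (b + c) - c = a + b by abel]
        exact add_mem (ES_mono f inl (lm ha))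
          (ES_mono f i0l (lh hb))
      exact Submodule.mem_sup_right ⟨hwI, by rwa [sub_eq_zero.1 this]⟩
  let R : Submodule ℂ L := sSup {I | IsBracketIdeal D.sl.bracket I ∧ I ⊓ D.h = ⊥}
  have hR : IsBracketIdeal D.sl.bracket R := by
    intro a v hv
    have h1 : R ≤ R.comap (D.sl.bracket a) :=
      sSup_le fun I hI x hx => (le_sSup hI : I ≤ R) (hI.1 a x hx).1
    have h2 : R ≤ R.comap (D.sl.bracket.flip a) :=
      sSup_le fun I hI x hx => (le_sSup hI : I ≤ R) (hI.1 a x hx).2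
    exact ⟨h1 hv, h2 hv⟩
  have hRle : R ≤ D.Nm ⊔ D.Np := sSup_le fun I hI =>
    (key I hI.1 hI.2).trans (sup_le_sup inf_le_right inf_le_right)
  have hRh : R ⊓ D.h = ⊥ := (disj.mono_left hRle).eq_bot
  have hmax : ∀ I : Submodule ℂ L, IsBracketIdeal D.sl.bracket I → I ⊓ D.h = ⊥ → I ≤ R :=
    fun I h1 h2 => le_sSup ⟨h1, h2⟩
  refine ⟨R, ⟨hR, hRh, hmax, le_antisymm (key R hR hRh) (sup_le inf_le_left inf_le_left)⟩, ?_⟩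
  rintro r ⟨r1, r2, r3, -⟩
  exact le_antisymm (hmax r r1 r2) (r3 R hR hRh)

end GT

/-- `𝔤̃(𝒜)` contains a unique maximal ideal `𝔯` among the ideals
intersecting `𝔥` trivially, and `𝔯 = (𝔯 ∩ 𝔫̃⁻) ⊕ (𝔯 ∩ 𝔫̃⁺)`. -/
theorem gtilde_unique_maximal_ideal
    {L : Type} [AddCommGroup L] [Module ℂ L] (D : CartanDatum L)
    (hpres : D.Presented) :
    ∃! r : Submodule ℂ L,
      IsBracketIdeal D.sl.bracket r ∧ r ⊓ D.h = ⊥ ∧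
      (∀ I : Submodule ℂ L, IsBracketIdeal D.sl.bracket I → I ⊓ D.h = ⊥ → I ≤ r) ∧
      r = (r ⊓ D.Nm) ⊔ (r ⊓ D.Np) := by
  exact GT.main D (by rw [eq_top_iff, ← GT.gen D hpres]; exact GT.tri_le D)
end

section
/- Let g(A) be a Clifford Kac-Moody algebra with one simple root α (so g_{±α} are irreducible h-modules and the integrability condition (ad g_{±α})^n g_{±α} = 0 holds for some n). If h_α does not annihilate g_α, then there exist homogeneous e ∈ g_α and f ∈ g_{−α} of the same parity such that the subalgebra they generate is isomorphic to sl(2) (if e,f even) or osp(1|2) (if e,f odd). -/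
/-- The weight space of weight `k·α`, for `k : ℤ`. -/
def zwtSp {L : Type*} [AddCommGroup L] [Module ℂ L]
    (sl : SuperLie L) (hE : Submodule ℂ L) (alpha : L →ₗ[ℂ] ℂ) (k : ℤ) : Submodule ℂ L :=
  ⨅ t : ↥hE, LinearMap.ker (sl.bracket t.1 - ((k : ℂ) * alpha t.1) • (LinearMap.id : L →ₗ[ℂ] L))

/-- A **Clifford Kac–Moody algebra with one simple root** `α`: the ambient Lie superalgebra
is `𝔤(𝒜)` for a Cartan datum with a single simple root (no nonzero ideals meeting `𝔥`
trivially, integer-weight decomposition), the root spaces `𝔤_{±α}` are irreducible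
`𝔥`-modules, and the integrability condition `(ad 𝔤_{±α})^N 𝔤_{±α} = 0` holds. -/
structure OneRootCKM (L : Type*) [AddCommGroup L] [Module ℂ L] where
  sl : SuperLie L
  hE : Submodule ℂ L
  hO : Submodule ℂ L
  hE_le : hE ≤ sl.even
  hO_le : hO ≤ sl.odd
  hfd : FiniteDimensional ℂ ↥(hE ⊔ hO)
  quasitoral : ∀ t ∈ hE, ∀ z ∈ hE ⊔ hO, sl.bracket t z = 0
  brOO : ∀ a ∈ hO, ∀ b ∈ hO, sl.bracket a b ∈ hE
  alpha : L →ₗ[ℂ] ℂ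
  alpha_ne : alpha.domRestrict hE ≠ 0
  gp : Submodule ℂ L
  gm : Submodule ℂ L
  gp_ne : gp ≠ ⊥
  gm_ne : gm ≠ ⊥
  gp_fd : FiniteDimensional ℂ ↥gp
  gm_fd : FiniteDimensional ℂ ↥gm
  gp_graded : gp = (gp ⊓ sl.even) ⊔ (gp ⊓ sl.odd)
  gm_graded : gm = (gm ⊓ sl.even) ⊔ (gm ⊓ sl.odd)
  gp_mod : ∀ t ∈ hE ⊔ hO, ∀ v ∈ gp, sl.bracket t v ∈ gp
  gm_mod : ∀ t ∈ hE ⊔ hO, ∀ v ∈ gm, sl.bracket t v ∈ gm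
  pair_mem : ∀ x ∈ gp, ∀ y ∈ gm, sl.bracket x y ∈ hE ⊔ hO
  nondeg_p : ∀ U : Submodule ℂ L, U ≤ gp → U ≠ ⊥ →
    (∀ t ∈ hE ⊔ hO, ∀ u ∈ U, sl.bracket t u ∈ U) →
    ∃ u ∈ U, ∃ v ∈ gm, sl.bracket u v ≠ 0
  nondeg_m : ∀ U : Submodule ℂ L, U ≤ gm → U ≠ ⊥ →
    (∀ t ∈ hE ⊔ hO, ∀ u ∈ U, sl.bracket t u ∈ U) →
    ∃ u ∈ U, ∃ v ∈ gp, sl.bracket v u ≠ 0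
  irr_p : ∀ U : Submodule ℂ L, U ≤ gp →
    (∀ t ∈ hE ⊔ hO, ∀ u ∈ U, sl.bracket t u ∈ U) → U = ⊥ ∨ U = gp
  irr_m : ∀ U : Submodule ℂ L, U ≤ gm →
    (∀ t ∈ hE ⊔ hO, ∀ u ∈ U, sl.bracket t u ∈ U) → U = ⊥ ∨ U = gm
  integrable : ∃ N : ℕ, adPow sl.bracket gp gp N = ⊥ ∧ adPow sl.bracket gm gm N = ⊥
  reduced : ∀ I : Submodule ℂ L, IsBracketIdeal sl.bracket I → I ⊓ (hE ⊔ hO) = ⊥ → I = ⊥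
  gp_eq : gp = zwtSp sl hE alpha 1
  gm_eq : gm = zwtSp sl hE alpha (-1)
  decomp : (⨆ k : ℤ, zwtSp sl hE alpha k) = ⊤

namespace OneRootCKM

variable {L : Type*} [AddCommGroup L] [Module ℂ L] (D : OneRootCKM L)

/-- The coroot space `𝔥_α = [𝔤_α, 𝔤_{-α}]`. -/
def coroot : Submodule ℂ L :=
  Submodule.span ℂ {z | ∃ x ∈ D.gp, ∃ y ∈ D.gm, z = D.sl.bracket x y}

/-- The bilinear form `B_α(H,K) = α([H,K])` (as a form on `L`; only its restriction
to the odd part of `𝔥` is relevant). -/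
noncomputable def Bform : L →ₗ[ℂ] L →ₗ[ℂ] ℂ := D.sl.bracket.compr₂ D.alpha

/-- The radical of `B_α` restricted to `𝔥₁ = hO`. -/
noncomputable def Brad : Submodule ℂ L :=
  D.hO ⊓ ⨅ K : ↥D.hO, LinearMap.ker (D.Bform.flip K.1)

/-- The rank of the simple root `α`: the rank of the symmetric bilinear form `B_α` on
`𝔥₁`. -/
noncomputable def rk : ℕ :=
  Module.finrank ℂ ↥D.hO - Module.finrank ℂ ↥D.Brad

end OneRootCKM

namespace OneRootCKM

variable {L : Type*} [AddCommGroup L] [Module ℂ L] (D : OneRootCKM L)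

theorem wt_p {t v : L} (ht : t ∈ D.hE) (hv : v ∈ D.gp) :
    D.sl.bracket t v = D.alpha t • v := by
  rw [D.gp_eq, zwtSp, Submodule.mem_iInf] at hv
  have := hv ⟨t, ht⟩
  simpa [sub_eq_zero] using this

theorem wt_m {t v : L} (ht : t ∈ D.hE) (hv : v ∈ D.gm) :
    D.sl.bracket t v = -(D.alpha t • v) := by
  rw [D.gm_eq, zwtSp, Submodule.mem_iInf] at hv
  have := hv ⟨t, ht⟩
  simp only [LinearMap.mem_ker, LinearMap.sub_apply, LinearMap.smul_apply, LinearMap.id_apply,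
    sub_eq_zero] at this
  rw [this]
  simp

theorem even_part {z : L} (hz : z ∈ D.hE ⊔ D.hO) (he : z ∈ D.sl.even) : z ∈ D.hE := by
  obtain ⟨a, ha, b, hb, rfl⟩ := Submodule.mem_sup.1 hz
  have h1 : b ∈ D.sl.even := by
    have := D.sl.even.sub_mem he (D.hE_le ha)
    simpa using this
  have : b = 0 := Submodule.disjoint_def.1 D.sl.compl.disjoint b h1 (D.hO_le hb)
  simpa [this] using ha

theorem odd_part {z : L} (hz : z ∈ D.hE ⊔ D.hO) (he : z ∈ D.sl.odd) : z ∈ D.hO := by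
  obtain ⟨a, ha, b, hb, rfl⟩ := Submodule.mem_sup.1 hz
  have h1 : a ∈ D.sl.odd := by
    have := D.sl.odd.sub_mem he (D.hO_le hb)
    simpa using this
  have : a = 0 := Submodule.disjoint_def.1 D.sl.compl.disjoint a (D.hE_le ha) h1
  simpa [this] using hb

theorem rad_ann {H : L} (hH : H ∈ D.hO) (h0 : ∀ K ∈ D.hO, D.alpha (D.sl.bracket H K) = 0) :
    ∀ v ∈ D.gp, D.sl.bracket H v = 0 := by
  have anti : ∀ K ∈ D.hO, ∀ v ∈ D.gp,
      D.sl.bracket H (D.sl.bracket K v) = - D.sl.bracket K (D.sl.bracket H v) := by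
    intro K hK v hv
    rw [D.sl.jacobi_oo H (D.hO_le hH) K (D.hO_le hK) v, D.wt_p (D.brOO H hH K hK) hv, h0 K hK]
    simp
  have sq : ∀ v ∈ D.gp, D.sl.bracket H (D.sl.bracket H v) = 0 := by
    intro v hv
    have h := anti H hH v hv
    rw [eq_neg_iff_add_eq_zero, ← two_smul ℂ] at h
    exact (smul_eq_zero.1 h).resolve_left two_ne_zero
  have key := D.irr_p (D.gp ⊓ LinearMap.ker (D.sl.bracket H)) inf_le_left ?_
  · have hle : D.gp ≤ D.gp ⊓ LinearMap.ker (D.sl.bracket H) := by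
      rcases key with h | h
      · exfalso
        apply D.gp_ne
        rw [eq_bot_iff]
        intro v hv
        have h1 : D.sl.bracket H v ∈ D.gp ⊓ LinearMap.ker (D.sl.bracket H) :=
          ⟨D.gp_mod H (Submodule.mem_sup_right hH) v hv, sq v hv⟩
        rw [h, Submodule.mem_bot] at h1
        have h2 : v ∈ D.gp ⊓ LinearMap.ker (D.sl.bracket H) := ⟨hv, h1⟩
        rwa [h] at h2
      · exact h.ge
    intro v hv
    exact (hle hv).2
  · rintro t ht u ⟨hu, hu2⟩
    refine ⟨D.gp_mod t ht u hu, ?_⟩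
    rw [SetLike.mem_coe, LinearMap.mem_ker] at hu2
    rw [SetLike.mem_coe, LinearMap.mem_ker]
    obtain ⟨a, ha, b, hb, rfl⟩ := Submodule.mem_sup.1 ht
    rw [map_add, LinearMap.add_apply, map_add, D.wt_p ha hu, anti b hb u hu, map_smul, hu2]
    simp

theorem exists_pair
    (hna : ¬ (∀ z ∈ D.coroot, ∀ v ∈ D.gp, D.sl.bracket z v = 0)) :
    ∃ e ∈ D.gp, ∃ f ∈ D.gm, D.alpha (D.sl.bracket e f) ≠ 0 ∧
      ((e ∈ D.sl.even ∧ f ∈ D.sl.even) ∨ (e ∈ D.sl.odd ∧ f ∈ D.sl.odd)) := by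
  by_contra hcon
  have H0 : ∀ e ∈ D.gp, ∀ f ∈ D.gm, e ∈ D.sl.even → f ∈ D.sl.even →
      D.alpha (D.sl.bracket e f) = 0 := fun e he f hf h1 h2 => by
    by_contra h
    exact hcon ⟨e, he, f, hf, h, Or.inl ⟨h1, h2⟩⟩
  have H1 : ∀ e ∈ D.gp, ∀ f ∈ D.gm, e ∈ D.sl.odd → f ∈ D.sl.odd →
      D.alpha (D.sl.bracket e f) = 0 := fun e he f hf h1 h2 => by
    by_contra h
    exact hcon ⟨e, he, f, hf, h, Or.inr ⟨h1, h2⟩⟩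
  have odds : ∀ K ∈ D.hO, K ∈ D.sl.odd := fun K hK => D.hO_le hK
  have mp : ∀ K ∈ D.hO, ∀ e ∈ D.gp, D.sl.bracket K e ∈ D.gp := fun K hK e he =>
    D.gp_mod K (Submodule.mem_sup_right hK) e he
  have mm : ∀ K ∈ D.hO, ∀ e ∈ D.gm, D.sl.bracket K e ∈ D.gm := fun K hK e he =>
    D.gm_mod K (Submodule.mem_sup_right hK) e he
  have hom : ∀ x ∈ D.gp, ∀ y ∈ D.gm, (x ∈ D.sl.even ∨ x ∈ D.sl.odd) →
      (y ∈ D.sl.even ∨ y ∈ D.sl.odd) →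
      ∀ v ∈ D.gp, D.sl.bracket (D.sl.bracket x y) v = 0 := by
    intro x hx y hy hxp hyp v hv
    have hm := D.pair_mem x hx y hy
    rcases hxp with hxp | hxp <;> rcases hyp with hyp | hyp
    · rw [D.wt_p (D.even_part hm (D.sl.ee_mem x hxp y hyp)) hv, H0 x hx y hy hxp hyp, zero_smul]
    · have ho := D.odd_part hm (D.sl.eo_mem x hxp y hyp)
      refine D.rad_ann ho (fun K hK => ?_) v hv
      rw [D.sl.symm_oo _ (odds _ ho) K (odds K hK), D.sl.jacobi_oe K (odds K hK) x hxp y, map_add,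
        H1 _ (mp K hK x hx) y hy (D.sl.oe_mem K (odds K hK) x hxp) hyp,
        H0 x hx _ (mm K hK y hy) hxp (D.sl.oo_mem K (odds K hK) y hyp), add_zero]
    · have ho := D.odd_part hm (D.sl.oe_mem x hxp y hyp)
      refine D.rad_ann ho (fun K hK => ?_) v hv
      rw [D.sl.symm_oo _ (odds _ ho) K (odds K hK), D.sl.jacobi_oo K (odds K hK) x hxp y, map_sub,
        H0 _ (mp K hK x hx) y hy (D.sl.oo_mem K (odds K hK) x hxp) hyp,
        H1 x hx _ (mm K hK y hy) hxp (D.sl.oe_mem K (odds K hK) y hyp), sub_zero]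
    · rw [D.wt_p (D.even_part hm (D.sl.oo_mem x hxp y hyp)) hv, H1 x hx y hy hxp hyp, zero_smul]
  apply hna
  intro z hz v hv
  rw [coroot] at hz
  induction hz using Submodule.span_induction with
  | zero => simp
  | add a b _ _ ha hb => rw [map_add, LinearMap.add_apply, ha, hb, add_zero]
  | smul c a _ ha => rw [map_smul, LinearMap.smul_apply, ha, smul_zero]
  | mem z hz =>
    obtain ⟨x, hx, y, hy, rfl⟩ := hz
    rw [D.gp_graded] at hx
    rw [D.gm_graded] at hy
    obtain ⟨x0, hx0, x1, hx1, rfl⟩ := Submodule.mem_sup.1 hx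
    obtain ⟨y0, hy0, y1, hy1, rfl⟩ := Submodule.mem_sup.1 hy
    simp only [map_add, LinearMap.add_apply]
    rw [hom x0 hx0.1 y0 hy0.1 (Or.inl hx0.2) (Or.inl hy0.2) v hv,
      hom x0 hx0.1 y1 hy1.1 (Or.inl hx0.2) (Or.inr hy1.2) v hv,
      hom x1 hx1.1 y0 hy0.1 (Or.inr hx1.2) (Or.inl hy0.2) v hv,
      hom x1 hx1.1 y1 hy1.1 (Or.inr hx1.2) (Or.inr hy1.2) v hv]
    simp

theorem scaled {e f : L} (he : e ∈ D.gp) (hf : f ∈ D.gm)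
    (hc : D.alpha (D.sl.bracket e f) ≠ 0) (ht : D.sl.bracket e f ∈ D.hE) (s : ℂ) (hs : s ≠ 0) :
    ∃ c : ℂ, e ≠ 0 ∧ c • f ≠ 0 ∧
      D.sl.bracket (D.sl.bracket e (c • f)) e = s • e ∧
      D.sl.bracket (D.sl.bracket e (c • f)) (c • f) = (-s) • (c • f) := by
  have hf0 : f ≠ 0 := by
    rintro rfl
    simp at hc
  refine ⟨s / D.alpha (D.sl.bracket e f), ?_, smul_ne_zero (div_ne_zero hs hc) hf0, ?_, ?_⟩
  · rintro rfl
    simp at hc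
  · rw [map_smul, map_smul, LinearMap.smul_apply, D.wt_p ht he, smul_smul, div_mul_cancel₀ _ hc]
  · set c := s / D.alpha (D.sl.bracket e f) with hcdef
    rw [map_smul (D.sl.bracket e), map_smul D.sl.bracket, LinearMap.smul_apply,
      D.wt_m ht (D.gm.smul_mem c hf), smul_neg, smul_smul, hcdef, div_mul_cancel₀ _ hc, neg_smul]

end OneRootCKM

/-- Let `𝔤(𝒜)` be a Clifford Kac–Moody algebra with one simple root `α`.
If `𝔥_α` does not annihilate `𝔤_α`, then there exist homogeneous `e ∈ 𝔤_α`, `f ∈ 𝔤_{-α}`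
of the same parity generating a subalgebra isomorphic to `𝔰𝔩(2)` (both even, with
`h = [e,f]`, `[h,e] = 2e`, `[h,f] = -2f`) or to `𝔬𝔰𝔭(1|2)` (both odd, with `[h,e] = e`,
`[h,f] = -f`). -/
theorem oneRoot_sl2_or_osp
    {L : Type} [AddCommGroup L] [Module ℂ L] (D : OneRootCKM L)
    (hna : ¬ (∀ z ∈ D.coroot, ∀ v ∈ D.gp, D.sl.bracket z v = 0)) :
    ∃ e ∈ D.gp, ∃ f ∈ D.gm, e ≠ 0 ∧ f ≠ 0 ∧
      ((e ∈ D.sl.even ∧ f ∈ D.sl.even ∧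
        D.sl.bracket (D.sl.bracket e f) e = (2 : ℂ) • e ∧
        D.sl.bracket (D.sl.bracket e f) f = (-2 : ℂ) • f) ∨
       (e ∈ D.sl.odd ∧ f ∈ D.sl.odd ∧
        D.sl.bracket (D.sl.bracket e f) e = e ∧
        D.sl.bracket (D.sl.bracket e f) f = -f)) := by
  obtain ⟨e, he, f, hf, hc, ⟨h1, h2⟩ | ⟨h1, h2⟩⟩ := D.exists_pair hna
  · obtain ⟨c, a1, a2, a3, a4⟩ := D.scaled he hf hc
      (D.even_part (D.pair_mem e he f hf) (D.sl.ee_mem e h1 f h2)) 2 two_ne_zero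
    exact ⟨e, he, c • f, D.gm.smul_mem c hf, a1, a2,
      Or.inl ⟨h1, D.sl.even.smul_mem c h2, a3, a4⟩⟩
  · obtain ⟨c, a1, a2, a3, a4⟩ := D.scaled he hf hc
      (D.even_part (D.pair_mem e he f hf) (D.sl.oo_mem e h1 f h2)) 1 one_ne_zero
    rw [one_smul] at a3
    rw [neg_smul, one_smul] at a4
    exact ⟨e, he, c • f, D.gm.smul_mem c hf, a1, a2,
      Or.inr ⟨h1, D.sl.odd.smul_mem c h2, a3, a4⟩⟩
end
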